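/- arXiv:1707.05148 — 3 statements merged into one kernel-verified Lean document; each statement's English description precedes it below -/
import Mathlib

section
/- Let G be a finite simple graph of order n having no connected component of order less than 3 and having no component isomorphic to the star K_{1, 2u+1} for any integer u ≥ 1. Then the modular edge-gracefulness satisfies k(G) = n if n ≡ 1 (mod 2); k(G) = n + 1 if n ≡ 2 (mod 4); and k(G) ≤ n + 1 if n ≡ 0 (mod 4). -/
/-- The weighted degree of a vertex `v` under an edge labeling `f` with values in an
additive Abelian group: the sum of the labels of all edges incident to `v`. -/
noncomputable def SimpleGraph.wdeg {V : Type} [Fintype V] (G : SimpleGraph V)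
    {A : Type} [AddCommGroup A] (f : Sym2 V → A) (v : V) : A :=
  ∑ u ∈ (G.neighborSet v).toFinite.toFinset, f s(v, u)

/-- An edge labeling `f` with values in an Abelian group `A` is `A`-irregular if the
weighted degrees of all vertices are pairwise distinct. -/
def SimpleGraph.IsIrregular {V : Type} [Fintype V] (G : SimpleGraph V)
    {A : Type} [AddCommGroup A] (f : Sym2 V → A) : Prop :=
  Function.Injective (G.wdeg f)

/-- The group irregularity strength `s_g(G)`: the smallest integer `s` such that for
every Abelian group of order `s` there exists a `𝒢`-irregular labeling of `G`. -/
noncomputable def SimpleGraph.groupIrregularityStrength {V : Type} [Fintype V]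
    (G : SimpleGraph V) : ℕ :=
  sInf {s : ℕ | ∀ (A : Type) [AddCommGroup A] [Fintype A],
    Fintype.card A = s → ∃ f : Sym2 V → A, G.IsIrregular f}

/-- The modular edge-gracefulness `k(G)`: the smallest integer `k ≥ |V(G)|` such that
there exists a `ℤ_k`-irregular labeling of `G`. -/
noncomputable def SimpleGraph.modularEdgeGracefulness {V : Type} [Fintype V]
    (G : SimpleGraph V) : ℕ :=
  sInf {k : ℕ | Fintype.card V ≤ k ∧ ∃ f : Sym2 V → ZMod k, G.IsIrregular f}

/-- `(X, Y)` is a bipartition of the connected component `c` of `G`: the two classes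
partition the vertex set of `c` and every edge of the component joins `X` and `Y`. -/
def SimpleGraph.IsComponentBipartition {V : Type} (G : SimpleGraph V)
    (c : G.ConnectedComponent) (X Y : Set V) : Prop :=
  X ∪ Y = c.supp ∧ Disjoint X Y ∧
    ∀ u v : V, u ∈ c.supp → v ∈ c.supp → G.Adj u v →
      ((u ∈ X ∧ v ∈ Y) ∨ (u ∈ Y ∧ v ∈ X))

/-- Data of a (hooked) Skolem sequence of order `m`; `M` is the set of positions. -/
def SkolemData (m : ℕ) (hook : Bool) (a : ℕ → ℕ) : Prop :=
  ∀ d e : ℕ, 1 ≤ d → d ≤ m → 1 ≤ e → e ≤ m →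
    1 ≤ a d ∧ (hook = false → a d + d ≤ 2 * m) ∧
    (hook = true → a d + d ≤ 2 * m + 1 ∧ a d + d ≠ 2 * m ∧ a d ≠ 2 * m) ∧
    (d ≠ e → a d ≠ a e ∧ a d + d ≠ a e + e) ∧ a d ≠ a e + e

set_option maxHeartbeats 2000000 in
lemma skolem_zero (s : ℕ) : SkolemData (4 * s) false (fun d =>
    if d % 2 = 0 then 6 * s - d / 2
    else if d = 1 then s
    else if d = 4 * s - 1 then 2 * s + 1
    else if d = 2 * s - 1 then 2 * s
    else if d = 2 * s + 1 then s - 1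
    else if d > 2 * s + 1 then (4 * s - 1 - d) / 2
    else s + 1 + (2 * s - 1 - d) / 2) := by
  intro d e hd hdm he hem
  simp only [Bool.false_eq_true, false_imp_iff, true_and, forall_const]
  split_ifs <;> omega

set_option maxHeartbeats 2000000 in
lemma skolem_one (s : ℕ) (hs : s ≠ 1) : SkolemData (4 * s + 1) false (fun d =>
    if d % 2 = 0 then 6 * s + 2 - d / 2
    else if d = 1 then s + 1
    else if d = 4 * s + 1 then 2 * s + 1
    else if d = 2 * s - 1 then 2 * s + 2
    else if d ≥ 2 * s + 1 then (4 * s + 1 - d) / 2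
    else s + 2 + (2 * s - 1 - d) / 2) := by
  intro d e hd hdm he hem
  simp only [Bool.false_eq_true, false_imp_iff, true_and, forall_const]
  split_ifs <;> omega

lemma skolem_five : SkolemData 5 false (fun d =>
    if d = 1 then 8 else if d = 2 then 1 else if d = 3 then 4 else if d = 4 then 2 else 5) := by
  intro d e hd hdm he hem
  simp only [Bool.false_eq_true, false_imp_iff, true_and, forall_const]
  split_ifs <;> omega

set_option maxHeartbeats 2000000 in
lemma skolem_two (s : ℕ) : SkolemData (4 * s + 2) true (fun d =>
    if d = 4 * s + 2 then 4 * s + 3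
    else if d % 2 = 0 then 2 * s + 1 - d / 2
    else if d = 4 * s + 1 then 2 * s + 1
    else if d = 1 then 7 * s + 3
    else if d = 2 * s + 1 then 4 * s + 2
    else if d > 2 * s + 1 then 4 * s + 3 + (4 * s + 1 - d) / 2
    else 5 * s + 2 + (2 * s + 1 - d) / 2) := by
  intro d e hd hdm he hem
  simp only [Bool.true_eq_false, false_imp_iff, true_and, forall_const]
  split_ifs <;> omega

set_option maxHeartbeats 2000000 in
lemma skolem_three (s : ℕ) (hs : 1 ≤ s) : SkolemData (4 * s - 1) true (fun d =>
    if d = 4 * s - 1 then 4 * s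
    else if d = 4 * s - 2 then 2 * s + 1
    else if d % 2 = 0 then 4 * s + (4 * s - 2 - d) / 2
    else if d = 1 then s
    else if d = 2 * s + 1 then s - 1
    else if d = 2 * s - 1 then 2 * s
    else if d > 2 * s + 1 then (4 * s - 1 - d) / 2
    else s + 1 + (2 * s - 1 - d) / 2) := by
  intro d e hd hdm he hem
  simp only [Bool.true_eq_false, false_imp_iff, true_and, forall_const]
  split_ifs <;> omega

lemma skolem_exists (m : ℕ) : ∃ hook a, SkolemData m hook a := by
  have h : m % 4 = 0 ∨ m % 4 = 1 ∨ m % 4 = 2 ∨ m % 4 = 3 := by omega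
  rcases h with h | h | h | h
  · obtain ⟨s, rfl⟩ : ∃ s, m = 4 * s := ⟨m / 4, by omega⟩
    exact ⟨_, _, skolem_zero s⟩
  · obtain ⟨s, rfl⟩ : ∃ s, m = 4 * s + 1 := ⟨m / 4, by omega⟩
    by_cases hs : s = 1
    · subst hs
      exact ⟨_, _, skolem_five⟩
    · exact ⟨_, _, skolem_one s hs⟩
  · obtain ⟨s, rfl⟩ : ∃ s, m = 4 * s + 2 := ⟨m / 4, by omega⟩
    exact ⟨_, _, skolem_two s⟩
  · obtain ⟨s, hs, rfl⟩ : ∃ s, 1 ≤ s ∧ m = 4 * s - 1 := ⟨m / 4 + 1, by omega, by omega⟩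
    exact ⟨_, _, skolem_three s hs⟩

open Multiset in
/-- `m` disjoint triples `{b, c, b + c}`. -/
lemma skolem_triples (m : ℕ) : ∃ T : Multiset (ℕ × ℕ), T.card = m ∧
    (T.bind (fun p => ({p.1, p.2, p.1 + p.2} : Multiset ℕ))).Nodup ∧
    ((∀ l ∈ T.bind (fun p => ({p.1, p.2, p.1 + p.2} : Multiset ℕ)), 1 ≤ l ∧ l ≤ 3 * m) ∨
     (∀ l ∈ T.bind (fun p => ({p.1, p.2, p.1 + p.2} : Multiset ℕ)),
        1 ≤ l ∧ l ≤ 3 * m + 1 ∧ l ≠ 3 * m)) := by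
  obtain ⟨hook, a, ha⟩ := skolem_exists m
  refine ⟨(Multiset.range m).map (fun d => (d + 1, a (d + 1) + m)), by simp, ?_, ?_⟩
  · rw [Multiset.bind_map, Multiset.nodup_bind]
    constructor
    · intro d hd
      have hd' := Multiset.mem_range.1 hd
      have := ha (d + 1) (d + 1) (by omega) (by omega) (by omega) (by omega)
      simp
      omega
    · refine (Multiset.nodup_range m).pairwise ?_
      intro d hd e he hde
      have hd' := Multiset.mem_range.1 hd
      have he' := Multiset.mem_range.1 he
      have h1 := ha (d + 1) (e + 1) (by omega) (by omega) (by omega) (by omega)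
      have h2 := ha (e + 1) (d + 1) (by omega) (by omega) (by omega) (by omega)
      rw [Function.onFun, Multiset.disjoint_left]
      intro x hx hx'
      simp at hx hx'
      omega
  · cases hook
    · left
      intro l hl
      simp only [Multiset.mem_bind, Multiset.mem_map, Multiset.mem_range] at hl
      obtain ⟨p, ⟨d, hd, rfl⟩, hl⟩ := hl
      have h1 := ha (d + 1) (d + 1) (by omega) (by omega) (by omega) (by omega)
      simp at hl h1
      omega
    · right
      intro l hl
      simp only [Multiset.mem_bind, Multiset.mem_map, Multiset.mem_range] at hl
      obtain ⟨p, ⟨d, hd, rfl⟩, hl⟩ := hl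
      have h1 := ha (d + 1) (d + 1) (by omega) (by omega) (by omega) (by omega)
      simp at hl h1
      omega

/-- The six elements `±b, ±c, ±(b+c)`. -/
def sixSet {A : Type} [AddCommGroup A] (p : A × A) : Multiset A :=
  {p.1, -p.1, p.2, -p.2, p.1 + p.2, -(p.1 + p.2)}

/-- The two elements `±s`. -/
def pairSet {A : Type} [AddCommGroup A] (s : A) : Multiset A := {s, -s}

/-- All the elements described by the triples `T` and the singles `Q`, up to sign. -/
def resSet {A : Type} [AddCommGroup A] (T : Multiset (A × A)) (Q : Multiset A) : Multiset A :=
  T.bind sixSet + Q.bind pairSet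

lemma resSet_add {A : Type} [AddCommGroup A] (T T' : Multiset (A × A)) (Q Q' : Multiset A) :
    resSet (T + T') (Q + Q') = resSet T Q + resSet T' Q' := by
  simp only [resSet, Multiset.add_bind]
  abel

lemma pair_nodup (k : ℕ) (hk : k % 2 = 1) (L : Finset ℕ)
    (h1 : ∀ l ∈ L, 1 ≤ l ∧ l < k) (h2 : ∀ l ∈ L, ∀ l' ∈ L, l ≠ l' → l + l' < k) :
    (L.val.bind (fun l => pairSet (l : ZMod k))).Nodup ∧
    (0 : ZMod k) ∉ L.val.bind (fun l => pairSet (l : ZMod k)) := by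
  have h0 : ∀ l : ℕ, 1 ≤ l → l < k → (l : ZMod k) ≠ 0 := by
    intro l hl hlk h
    rw [ZMod.natCast_eq_zero_iff] at h
    exact absurd (Nat.le_of_dvd hl h) (by omega)
  have h3 : ∀ l ∈ L, (l : ZMod k) ≠ -(l : ZMod k) := by
    intro l hl h
    have h4 : ((2 * l : ℕ) : ZMod k) = 0 := by
      push_cast
      rw [two_mul]
      nth_rewrite 1 [h]
      simp
    rw [ZMod.natCast_eq_zero_iff] at h4
    have h5 : k ∣ l := by
      refine Nat.Coprime.dvd_of_dvd_mul_left ?_ h4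
      rw [Nat.coprime_comm, Nat.coprime_two_left, Nat.odd_iff]
      exact hk
    have := h1 l hl
    exact absurd (Nat.le_of_dvd (by omega) h5) (by omega)
  have h4 : ∀ l ∈ L, ∀ l' ∈ L, l ≠ l' → (l : ZMod k) ≠ l' := by
    intro l hl l' hl' hne h
    rw [ZMod.natCast_eq_natCast_iff'] at h
    rw [Nat.mod_eq_of_lt (h1 l hl).2, Nat.mod_eq_of_lt (h1 l' hl').2] at h
    exact hne h
  have h5 : ∀ l ∈ L, ∀ l' ∈ L, l ≠ l' → (l : ZMod k) ≠ -l' := by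
    intro l hl l' hl' hne h
    have h6 : ((l + l' : ℕ) : ZMod k) = 0 := by
      push_cast
      rw [h]; simp
    exact h0 (l + l') (by have := h1 l hl; omega) (h2 l hl l' hl' hne) h6
  constructor
  · rw [Multiset.nodup_bind]
    constructor
    · intro l hl
      simpa [pairSet] using h3 l hl
    · refine L.nodup.pairwise ?_
      intro l hl l' hl' hne
      rw [Function.onFun, Multiset.disjoint_left]
      intro x hx hx'
      simp only [pairSet, Multiset.mem_cons, Multiset.mem_singleton, Multiset.insert_eq_cons]
        at hx hx'
      rcases hx with rfl | rfl <;> rcases hx' with h | h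
      · exact h4 l hl l' hl' hne h
      · exact h5 l hl l' hl' hne h
      · exact h5 l' hl' l hl hne.symm h.symm
      · exact h4 l hl l' hl' hne (neg_injective h)
  · intro h
    simp only [pairSet, Multiset.mem_bind, Multiset.mem_cons, Multiset.mem_singleton,
      Multiset.insert_eq_cons] at h
    obtain ⟨l, hl, h | h⟩ := h
    · exact h0 l (h1 l hl).1 (h1 l hl).2 h.symm
    · exact h0 l (h1 l hl).1 (h1 l hl).2 (neg_eq_zero.1 h.symm)

lemma res_exists (m q k : ℕ) (hk : k = 2 * (3 * m + q) + 1) :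
    ∃ (T : Multiset (ZMod k × ZMod k)) (Q : Multiset (ZMod k)), T.card = m ∧ Q.card = q ∧
      (resSet T Q).Nodup ∧ 0 ∉ resSet T Q := by
  obtain ⟨T, hT, hnd, hb⟩ := skolem_triples m
  set S : Multiset ℕ := T.bind (fun p => ({p.1, p.2, p.1 + p.2} : Multiset ℕ)) with hS
  have hSc : S.card = 3 * m := by
    rw [hS, Multiset.card_bind]
    simp [hT, mul_comm]
  obtain ⟨L, hSL, hLc, h1, h2⟩ : ∃ L : Finset ℕ, S ≤ L.val ∧ L.card = 3 * m + q ∧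
      (∀ l ∈ L, 1 ≤ l ∧ l < k) ∧ (∀ l ∈ L, ∀ l' ∈ L, l ≠ l' → l + l' < k) := by
    by_cases hsub : ∀ l ∈ S, 1 ≤ l ∧ l ≤ 3 * m + q
    · refine ⟨Finset.Icc 1 (3 * m + q), ?_, by simp, ?_, ?_⟩
      · rw [Multiset.le_iff_subset hnd]
        intro l hl
        have := hsub l hl
        simpa using this
      · intro l hl
        rw [Finset.mem_Icc] at hl
        omega
      · intro l hl l' hl' _
        rw [Finset.mem_Icc] at hl hl'
        omega
    · rcases hb with hb | hb
      · exact absurd (fun l hl => ⟨(hb l hl).1, by have := hb l hl; omega⟩) hsub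
      · have hq : q = 0 := by
          by_contra hq
          exact hsub (fun l hl => ⟨(hb l hl).1, by have := hb l hl; omega⟩)
        refine ⟨⟨S, hnd⟩, le_rfl, by simp [hSc, hq], ?_, ?_⟩
        · intro l hl
          have hm : 0 < 3 * m := by
            rw [← hSc]; exact Multiset.card_pos_iff_exists_mem.2 ⟨l, hl⟩
          have := hb l hl
          omega
        · intro l hl l' hl' _
          have := hb l hl
          have := hb l' hl'
          omega
  obtain ⟨hn, hz⟩ := pair_nodup k (by omega) L h1 h2
  have hLe : L.val = S + (L.val - S) := (add_tsub_cancel_of_le hSL).symm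
  have key : resSet (T.map (fun p => ((p.1 : ZMod k), (p.2 : ZMod k))))
      ((L.val - S).map (fun l : ℕ => (l : ZMod k))) =
      L.val.bind (fun l => pairSet (l : ZMod k)) := by
    conv_rhs => rw [hLe]
    rw [Multiset.add_bind, resSet, Multiset.bind_map, Multiset.bind_map, hS,
      Multiset.bind_assoc]
    congr 1
    refine Multiset.bind_congr ?_
    intro p _
    simp only [sixSet, pairSet, Multiset.insert_eq_cons, Multiset.cons_bind,
      Multiset.singleton_bind, Nat.cast_add]
    generalize -((p.1 : ZMod k) + p.2) = e
    simp only [← Multiset.singleton_add]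
    abel
  refine ⟨_, _, ?_, ?_, key ▸ hn, key ▸ hz⟩
  · simp [hT]
  · rw [Multiset.card_map, Multiset.card_sub hSL, hSc]
    simp only [Finset.card_val, hLc]
    omega

lemma Multiset.split_card {α : Type} (M : Multiset α) (a b : ℕ) (h : M.card = a + b) :
    ∃ M1 M2 : Multiset α, M = M1 + M2 ∧ M1.card = a ∧ M2.card = b := by
  induction M using Quotient.inductionOn with
  | _ l =>
    simp only [Multiset.quot_mk_to_coe, Multiset.coe_card] at h
    refine ⟨(l.take a : List α), (l.drop a : List α), ?_, ?_, ?_⟩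
    · simp [Multiset.coe_add]
    · simp; omega
    · simp; omega

lemma pairs_sum {A : Type} [AddCommGroup A] (Q : Multiset A) : (Q.bind pairSet).sum = 0 := by
  rw [Multiset.sum_bind]
  simp [pairSet]

lemma pairs_card {A : Type} [AddCommGroup A] (Q : Multiset A) :
    (Q.bind pairSet).card = 2 * Q.card := by
  rw [Multiset.card_bind]
  simp [pairSet, Function.comp_def, mul_comm]

/-- The sizes of the two classes that we can handle. -/
def OkSize (x y : ℕ) : Prop :=
  1 ≤ x ∧ 1 ≤ y ∧ 3 ≤ x + y ∧ ¬(x = 1 ∧ y % 2 = 1) ∧ ¬(y = 1 ∧ x % 2 = 1)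

/-- Split `M + pairs` over two classes. -/
lemma comp_general {A : Type} [AddCommGroup A] (x y u v : ℕ) (M1 M2 Q : Multiset A)
    (hs : M1.sum = M2.sum) (hx : x = M1.card + 2 * u) (hy : y = M2.card + 2 * v)
    (hQ : Q.card = u + v) :
    ∃ MX MY : Multiset A, MX.card = x ∧ MY.card = y ∧ MX.sum = MY.sum ∧
      MX + MY = M1 + M2 + Q.bind pairSet := by
  obtain ⟨Q1, Q2, rfl, h1, h2⟩ := Q.split_card u v hQ
  refine ⟨M1 + Q1.bind pairSet, M2 + Q2.bind pairSet, ?_, ?_, ?_, ?_⟩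
  · rw [Multiset.card_add, pairs_card, h1, hx]
  · rw [Multiset.card_add, pairs_card, h2, hy]
  · rw [Multiset.sum_add, Multiset.sum_add, pairs_sum, pairs_sum, hs]
  · rw [Multiset.add_bind]; abel

lemma comp_odd {A : Type} [AddCommGroup A] (x y : ℕ) (h : OkSize x y) (ho : (x + y) % 2 = 1)
    (b c : A) (Q : Multiset A) (hQ : 2 * Q.card + 3 = x + y) :
    ∃ MX MY : Multiset A, MX.card = x ∧ MY.card = y ∧ MX.sum = MY.sum ∧
      MX + MY = {b, c, b + c} + Q.bind pairSet := by
  obtain ⟨h1, h2, h3, h4, h5⟩ := h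
  by_cases hx : x % 2 = 1
  · obtain ⟨MX, MY, e1, e2, e3, e4⟩ := comp_general x y ((x - 1) / 2) ((y - 2) / 2)
      {b + c} {b, c} Q (by simp) (by simp; omega) (by simp; omega) (by omega)
    refine ⟨MX, MY, e1, e2, e3, e4.trans ?_⟩
    simp only [Multiset.insert_eq_cons, ← Multiset.singleton_add]
    abel
  · obtain ⟨MX, MY, e1, e2, e3, e4⟩ := comp_general x y ((x - 2) / 2) ((y - 1) / 2)
      {b, c} {b + c} Q (by simp) (by simp; omega) (by simp; omega) (by omega)
    refine ⟨MX, MY, e1, e2, e3, e4.trans ?_⟩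
    simp only [Multiset.insert_eq_cons, ← Multiset.singleton_add]
    abel

/-- Solvability of the subfamily `S` with resources `m`, `q`, `z`. -/
def Assem {ι : Type} (x y : ι → ℕ) (S : Finset ι) (m q z : ℕ) : Prop :=
  ∀ (A : Type) [AddCommGroup A] (T : Multiset (A × A)) (Q : Multiset A),
    T.card = m → Q.card = q → ∃ MX MY : ι → Multiset A,
      (∀ i ∈ S, (MX i).card = x i ∧ (MY i).card = y i ∧ (MX i).sum = (MY i).sum) ∧
      ∑ i ∈ S, (MX i + MY i) = resSet T Q + Multiset.replicate z 0

lemma Assem.union {ι : Type} [DecidableEq ι] {x y : ι → ℕ} {S S' : Finset ι}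
    {m q m' q' z : ℕ} (h : Assem x y S m q 0) (h' : Assem x y S' m' q' z)
    (hd : Disjoint S S') : Assem x y (S ∪ S') (m + m') (q + q') z := by
  intro A _ T Q hT hQ
  obtain ⟨T1, T2, rfl, t1, t2⟩ := T.split_card m m' hT
  obtain ⟨Q1, Q2, rfl, q1, q2⟩ := Q.split_card q q' hQ
  obtain ⟨MX, MY, a1, a2⟩ := h A T1 Q1 t1 q1
  obtain ⟨MX', MY', b1, b2⟩ := h' A T2 Q2 t2 q2
  refine ⟨fun i => if i ∈ S then MX i else MX' i, fun i => if i ∈ S then MY i else MY' i, ?_, ?_⟩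
  · intro i hi
    by_cases his : i ∈ S
    · simpa [his] using a1 i his
    · have : i ∈ S' := by simpa [his] using hi
      simpa [his] using b1 i this
  · rw [Finset.sum_union hd, resSet_add]
    have e1 : ∑ i ∈ S, ((if i ∈ S then MX i else MX' i) + (if i ∈ S then MY i else MY' i)) =
        ∑ i ∈ S, (MX i + MY i) := Finset.sum_congr rfl (fun i hi => by simp [hi])
    have e2 : ∑ i ∈ S', ((if i ∈ S then MX i else MX' i) + (if i ∈ S then MY i else MY' i)) =
        ∑ i ∈ S', (MX' i + MY' i) := by
      refine Finset.sum_congr rfl (fun i hi => ?_)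
      have : i ∉ S := Finset.disjoint_right.1 hd hi
      simp [this]
    rw [e1, e2, a2, b2]
    simp only [Multiset.replicate_zero]
    abel

lemma assem_even {ι : Type} (x y : ι → ℕ) (i : ι) (h : OkSize (x i) (y i))
    (he : (x i + y i) % 2 = 0) : ∃ m q, 6 * m + 2 * q = x i + y i ∧ Assem x y {i} m q 0 := by
  obtain ⟨h1, h2, h3, h4, h5⟩ := h
  by_cases hx : x i % 2 = 1
  · refine ⟨1, (x i + y i - 6) / 2, by omega, ?_⟩
    intro A _ T Q hT hQ
    obtain ⟨⟨b, c⟩, rfl⟩ := Multiset.card_eq_one.1 hT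
    obtain ⟨MX, MY, e1, e2, e3, e4⟩ := comp_general (x i) (y i) ((x i - 3) / 2) ((y i - 3) / 2)
      {b, c, -(b + c)} {-b, -c, b + c} Q (by simp) (by simp; omega) (by simp; omega)
      (by omega)
    refine ⟨fun _ => MX, fun _ => MY, ?_, ?_⟩
    · intro j hj
      rw [Finset.mem_singleton.1 hj]
      exact ⟨e1, e2, e3⟩
    · rw [Finset.sum_singleton, e4]
      simp only [resSet, sixSet, Multiset.singleton_bind, Multiset.insert_eq_cons,
        ← Multiset.singleton_add, Multiset.replicate_zero]
      abel
  · refine ⟨0, (x i + y i) / 2, by omega, ?_⟩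
    intro A _ T Q hT hQ
    obtain rfl := Multiset.card_eq_zero.1 hT
    obtain ⟨MX, MY, e1, e2, e3, e4⟩ := comp_general (x i) (y i) (x i / 2) (y i / 2)
      0 0 Q (by simp) (by simp; omega) (by simp; omega) (by omega)
    refine ⟨fun _ => MX, fun _ => MY, ?_, ?_⟩
    · intro j hj
      rw [Finset.mem_singleton.1 hj]
      exact ⟨e1, e2, e3⟩
    · rw [Finset.sum_singleton, e4]
      simp [resSet]

lemma assem_single {ι : Type} (x y : ι → ℕ) (i : ι)
    (ho : (x i + y i) % 2 = 1) : ∃ q, 2 * q + 1 = x i + y i ∧ Assem x y {i} 0 q 1 := by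
  refine ⟨(x i + y i) / 2, by omega, ?_⟩
  intro A _ T Q hT hQ
  obtain rfl := Multiset.card_eq_zero.1 hT
  by_cases hx : x i % 2 = 1
  · obtain ⟨MX, MY, e1, e2, e3, e4⟩ := comp_general (x i) (y i) (x i / 2) (y i / 2)
      {0} 0 Q (by simp) (by simp; omega) (by simp; omega) (by omega)
    refine ⟨fun _ => MX, fun _ => MY, ?_, ?_⟩
    · intro j hj
      rw [Finset.mem_singleton.1 hj]
      exact ⟨e1, e2, e3⟩
    · rw [Finset.sum_singleton, e4]
      simp only [resSet, Multiset.zero_bind, Multiset.replicate_one]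
      abel
  · obtain ⟨MX, MY, e1, e2, e3, e4⟩ := comp_general (x i) (y i) (x i / 2) (y i / 2)
      0 {0} Q (by simp) (by simp; omega) (by simp; omega) (by omega)
    refine ⟨fun _ => MX, fun _ => MY, ?_, ?_⟩
    · intro j hj
      rw [Finset.mem_singleton.1 hj]
      exact ⟨e1, e2, e3⟩
    · rw [Finset.sum_singleton, e4]
      simp only [resSet, Multiset.zero_bind, Multiset.replicate_one]
      abel

lemma assem_two {ι : Type} [DecidableEq ι] (x y : ι → ℕ) (i j : ι) (hij : i ≠ j)
    (hi : OkSize (x i) (y i)) (hj : OkSize (x j) (y j))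
    (hio : (x i + y i) % 2 = 1) (hjo : (x j + y j) % 2 = 1) :
    ∃ q, 6 * 1 + 2 * q = x i + y i + (x j + y j) ∧ Assem x y {i, j} 1 q 0 := by
  have hi3 := hi.2.2.1
  have hj3 := hj.2.2.1
  refine ⟨(x i + y i - 3) / 2 + (x j + y j - 3) / 2, by omega, ?_⟩
  intro A _ T Q hT hQ
  obtain ⟨⟨b, c⟩, rfl⟩ := Multiset.card_eq_one.1 hT
  obtain ⟨Q1, Q2, rfl, q1, q2⟩ := Q.split_card _ _ hQ
  obtain ⟨MX, MY, e1, e2, e3, e4⟩ := comp_odd (x i) (y i) hi hio b c Q1 (by omega)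
  obtain ⟨MX', MY', f1, f2, f3, f4⟩ := comp_odd (x j) (y j) hj hjo (-b) (-c) Q2 (by omega)
  refine ⟨fun t => if t = i then MX else MX', fun t => if t = i then MY else MY', ?_, ?_⟩
  · intro t ht
    by_cases hti : t = i
    · subst hti
      simpa using ⟨e1, e2, e3⟩
    · have : t = j := by simpa [hti] using ht
      subst this
      simpa [hti] using ⟨f1, f2, f3⟩
  · rw [Finset.sum_pair hij]
    simp only [if_true, hij.symm, if_false]
    rw [e4, f4, ← neg_add]
    simp only [resSet, sixSet, Multiset.singleton_bind, Multiset.insert_eq_cons,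
        ← Multiset.singleton_add, Multiset.replicate_zero, Multiset.add_bind]
    generalize -(b + c) = d
    abel

lemma assem_exists {ι : Type} [DecidableEq ι] (x y : ι → ℕ) (N : ℕ) :
    ∀ S : Finset ι, S.card = N → (∀ i ∈ S, OkSize (x i) (y i)) →
    ∃ m q z, z ≤ 1 ∧ 6 * m + 2 * q + z = ∑ i ∈ S, (x i + y i) ∧ Assem x y S m q z := by
  induction N using Nat.strong_induction_on with
  | _ N ih =>
    intro S hS hok
    by_cases hE : ∃ i ∈ S, (x i + y i) % 2 = 0
    · obtain ⟨i, hi, he⟩ := hE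
      obtain ⟨m, q, h1, h2⟩ := assem_even x y i (hok i hi) he
      obtain ⟨m', q', z, hz, h3, h4⟩ := ih (N - 1)
        (by have := Finset.card_pos.2 ⟨i, hi⟩; omega) (S.erase i)
        (by rw [Finset.card_erase_of_mem hi, hS]) (fun j hj => hok j (Finset.mem_of_mem_erase hj))
      have hu : {i} ∪ S.erase i = S := by
        rw [← Finset.insert_eq, Finset.insert_erase hi]
      have hd : Disjoint {i} (S.erase i) := by simp
      refine ⟨m + m', q + q', z, hz, ?_, hu ▸ h2.union h4 hd⟩
      rw [← hu, Finset.sum_union hd, Finset.sum_singleton, ← h3, ← h1]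
      ring
    · push Not at hE
      have hO : ∀ i ∈ S, (x i + y i) % 2 = 1 := fun i hi => by have := hE i hi; omega
      by_cases h1 : 1 < S.card
      · obtain ⟨i, hi, j, hj, hij⟩ := Finset.one_lt_card.1 h1
        obtain ⟨q, h1, h2⟩ := assem_two x y i j hij (hok i hi) (hok j hj) (hO i hi) (hO j hj)
        have hsub : {i, j} ⊆ S := by
          intro t ht
          simp at ht
          rcases ht with rfl | rfl <;> assumption
        obtain ⟨m', q', z, hz, h3, h4⟩ := ih (N - 2) (by omega) (S \ {i, j})
          (by rw [Finset.card_sdiff_of_subset hsub, hS, Finset.card_pair hij])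
          (fun j hj => hok j (Finset.mem_sdiff.1 hj).1)
        have hu : {i, j} ∪ S \ {i, j} = S := Finset.union_sdiff_of_subset hsub
        have hd : Disjoint {i, j} (S \ {i, j}) := Finset.disjoint_sdiff
        refine ⟨1 + m', q + q', z, hz, ?_, hu ▸ h2.union h4 hd⟩
        rw [← hu, Finset.sum_union hd, Finset.sum_pair hij, ← h3, ← h1]
        ring
      · by_cases h0 : S.card = 0
        · rw [Finset.card_eq_zero] at h0
          subst h0
          refine ⟨0, 0, 0, by omega, by simp, ?_⟩
          intro A _ T Q hT hQ
          obtain rfl := Multiset.card_eq_zero.1 hT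
          obtain rfl := Multiset.card_eq_zero.1 hQ
          exact ⟨fun _ => 0, fun _ => 0, by simp, by simp [resSet]⟩
        · obtain ⟨i, rfl⟩ := Finset.card_eq_one.1 (by omega : S.card = 1)
          obtain ⟨q, h1, h2⟩ := assem_single x y i (hO i (by simp))
          exact ⟨0, q, 1, le_rfl, by simp; omega, h2⟩

/-- The numerical core. -/
lemma core_exists {ι : Type} [Fintype ι] (x y : ι → ℕ) (hok : ∀ i, OkSize (x i) (y i))
    (n k : ℕ) (hn : ∑ i, (x i + y i) = n) (hk : k % 2 = 1) (hkn : k = n ∨ k = n + 1) :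
    ∃ MX MY : ι → Multiset (ZMod k),
      (∀ i, (MX i).card = x i ∧ (MY i).card = y i ∧ (MX i).sum = (MY i).sum) ∧
      (∑ i, (MX i + MY i)).Nodup := by
  classical
  obtain ⟨m, q, z, hz, h1, h2⟩ := assem_exists x y _ Finset.univ rfl (fun i _ => hok i)
  obtain ⟨T, Q, hT, hQ, hnd, h0⟩ := res_exists m q k (by omega)
  obtain ⟨MX, MY, h3, h4⟩ := h2 (ZMod k) T Q hT hQ
  refine ⟨MX, MY, fun i => h3 i (Finset.mem_univ i), ?_⟩
  rw [h4]
  obtain rfl | rfl : z = 0 ∨ z = 1 := by omega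
  · simpa using hnd
  · rw [Multiset.replicate_one, add_comm, Multiset.singleton_add, Multiset.nodup_cons]
    exact ⟨h0, hnd⟩

/-- The weighted-degree vectors that can be realized by an edge labeling. -/
def wdegRange {V : Type} [Fintype V] (G : SimpleGraph V) (A : Type) [AddCommGroup A] :
    AddSubgroup (V → A) where
  carrier := {w | ∃ f : Sym2 V → A, G.wdeg f = w}
  zero_mem' := ⟨0, by funext v; simp [SimpleGraph.wdeg]⟩
  add_mem' := by
    rintro _ _ ⟨f, rfl⟩ ⟨g, rfl⟩
    exact ⟨f + g, by funext v; simp [SimpleGraph.wdeg, Finset.sum_add_distrib]⟩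
  neg_mem' := by
    rintro _ ⟨f, rfl⟩
    exact ⟨-f, by funext v; simp [SimpleGraph.wdeg]⟩

lemma edge_mem {V : Type} [Fintype V] [DecidableEq V] (G : SimpleGraph V) {A : Type}
    [AddCommGroup A] {u v : V} (h : G.Adj u v) (a : A) :
    (Pi.single u a + Pi.single v a : V → A) ∈ wdegRange G A := by
  have hne : u ≠ v := h.ne
  refine ⟨fun e => if e = s(u, v) then a else 0, ?_⟩
  funext x
  simp only [SimpleGraph.wdeg, Pi.add_apply]
  by_cases hxu : x = u
  · subst hxu
    rw [Finset.sum_eq_single_of_mem v (by simpa using h)]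
    · simp [hne]
    · intro t _ htv
      simp [htv, hne]
  · by_cases hxv : x = v
    · subst hxv
      rw [Finset.sum_eq_single_of_mem u (by simpa using h.symm)]
      · simp [hxu, Sym2.eq_swap]
      · intro t _ htv
        simp [htv, hxu]
    · rw [Finset.sum_eq_zero]
      · simp [hxu, hxv]
      · intro t _
        simp [hxu, hxv]

lemma walk_mem {V : Type} [Fintype V] [DecidableEq V] (G : SimpleGraph V) {A : Type}
    [AddCommGroup A] {u v : V} (p : G.Walk u v) (a : A) :
    (Even p.length → (Pi.single u a - Pi.single v a : V → A) ∈ wdegRange G A) ∧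
    (Odd p.length → (Pi.single u a + Pi.single v a : V → A) ∈ wdegRange G A) := by
  induction p with
  | nil => simp
  | @cons u t v h p ih =>
    have he := edge_mem G h a
    constructor
    · intro hp
      have hp' : Odd p.length := by
        rw [SimpleGraph.Walk.length_cons] at hp
        grind
      have := AddSubgroup.sub_mem _ he (ih.2 hp')
      convert this using 1
      abel
    · intro hp
      have hp' : Even p.length := by
        rw [SimpleGraph.Walk.length_cons] at hp
        grind
      have := AddSubgroup.sub_mem _ he (ih.1 hp')
      convert this using 1
      abel

lemma star_iso {V : Type} [Fintype V] (G : SimpleGraph V) (c : G.ConnectedComponent) (s : V)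
    (Y : Finset V) (u : ℕ) (hsY : s ∉ Y) (hC : ∀ v, v ∈ c.supp ↔ v = s ∨ v ∈ Y)
    (hcard : Y.card = 2 * u + 1) (hadj : ∀ v ∈ Y, ∀ t, G.Adj v t ↔ t = s) :
    Nonempty (G.induce c.supp ≃g completeBipartiteGraph Unit (Fin (2 * u + 1))) := by
  have e : Fin (2 * u + 1) ≃ Y := (Finset.equivFinOfCardEq hcard).symm
  let g : Unit ⊕ Fin (2 * u + 1) → c.supp :=
    Sum.elim (fun _ => ⟨s, (hC s).2 (Or.inl rfl)⟩)
      (fun i => ⟨(e i).1, (hC _).2 (Or.inr (e i).2)⟩)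
  have hg : Function.Bijective g := by
    constructor
    · rintro (a | i) (b | j) hab
      · rfl
      · have h1 : s = (e j).1 := congrArg Subtype.val hab
        exact absurd (h1 ▸ (e j).2) hsY
      · have h1 : (e i).1 = s := congrArg Subtype.val hab
        exact absurd (h1 ▸ (e i).2) hsY
      · have h1 : (e i).1 = (e j).1 := congrArg (fun t : c.supp => t.1) hab
        rw [e.injective (Subtype.ext h1)]
    · rintro ⟨v, hv⟩
      rcases (hC v).1 hv with rfl | hv'
      · exact ⟨Sum.inl (), rfl⟩
      · refine ⟨Sum.inr (e.symm ⟨v, hv'⟩), ?_⟩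
        apply Subtype.ext
        simp [g]
  refine ⟨(RelIso.symm ⟨Equiv.ofBijective g hg, ?_⟩ :
    G.induce c.supp ≃g completeBipartiteGraph Unit (Fin (2 * u + 1)))⟩
  rintro (a | i) (b | j)
  · simp [g]
  · have h1 := (hadj _ (e j).2 s).2 rfl
    simpa [g] using h1.symm
  · have h1 := (hadj _ (e i).2 s).2 rfl
    simpa [g] using h1
  · have h1 : ¬ G.Adj (e i).1 (e j).1 := by
      rw [hadj _ (e i).2]
      intro h
      exact hsY (h ▸ (e j).2)
    simpa [g] using h1

lemma comp_exists {V : Type} [Fintype V] [DecidableEq V] (G : SimpleGraph V)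
    (A : Type) [AddCommGroup A] (h2 : ∀ a : A, ∃ b, a = b + b)
    (c : G.ConnectedComponent) (h3 : 3 ≤ c.supp.ncard)
    (hstar : ∀ (u : ℕ), 1 ≤ u →
      ¬ Nonempty (G.induce c.supp ≃g completeBipartiteGraph Unit (Fin (2 * u + 1)))) :
    ∃ X Y : Finset V, Disjoint X Y ∧ (∀ v, v ∈ X ∪ Y ↔ G.connectedComponentMk v = c) ∧
      OkSize X.card Y.card ∧ ∀ w : V → A, ∑ v ∈ X, w v = ∑ v ∈ Y, w v →
        ∑ v ∈ X ∪ Y, Pi.single v (w v) ∈ wdegRange G A := by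
  classical
  set C : Finset V := Finset.univ.filter (fun v => G.connectedComponentMk v = c) with hCdef
  have hC : ∀ v, v ∈ C ↔ G.connectedComponentMk v = c := by simp [hCdef]
  have hCc : 3 ≤ C.card := by
    have : c.supp = (C : Set V) := by
      ext v; simp [hC]
    rwa [this, Set.ncard_coe_finset] at h3
  obtain ⟨r, hr⟩ : ∃ r, G.connectedComponentMk r = c := c.exists_rep
  have hreach : ∀ v ∈ C, Nonempty (G.Walk r v) := by
    intro v hv
    rw [hC, ← hr, SimpleGraph.ConnectedComponent.eq] at hv
    exact hv.symm
  have hmemC : ∀ v, G.Walk r v → v ∈ C := by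
    intro v p
    rw [hC, ← hr, SimpleGraph.ConnectedComponent.eq]
    exact p.reachable.symm
  by_cases hb : ∃ v, (∃ p : G.Walk r v, Even p.length) ∧ (∃ p : G.Walk r v, Odd p.length)
  · obtain ⟨v, ⟨p, hp⟩, ⟨p', hp'⟩⟩ := hb
    have hrm : ∀ a : A, (Pi.single r a : V → A) ∈ wdegRange G A := by
      intro a
      obtain ⟨b, rfl⟩ := h2 a
      have := AddSubgroup.add_mem _ ((walk_mem G p b).1 hp) ((walk_mem G p' b).2 hp')
      convert this using 1
      rw [Pi.single_add]
      abel
    have hall : ∀ v ∈ C, ∀ a : A, (Pi.single v a : V → A) ∈ wdegRange G A := by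
      intro v hv a
      obtain ⟨p⟩ := hreach v hv
      rcases Nat.even_or_odd p.length with h | h
      · have := AddSubgroup.sub_mem _ (hrm a) ((walk_mem G p a).1 h)
        simpa using this
      · have := AddSubgroup.sub_mem _ ((walk_mem G p a).2 h) (hrm a)
        simpa using this
    obtain ⟨X, hX, hXc⟩ := Finset.exists_subset_card_eq
      (show (if C.card % 2 = 1 then 1 else 2) ≤ C.card by split_ifs <;> omega)
    refine ⟨X, C \ X, Finset.disjoint_sdiff, ?_, ?_, ?_⟩
    · intro v
      rw [Finset.union_sdiff_of_subset hX, hC]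
    · rw [Finset.card_sdiff_of_subset hX, hXc]
      unfold OkSize
      split_ifs <;> omega
    · intro w _
      rw [Finset.union_sdiff_of_subset hX]
      exact AddSubgroup.sum_mem _ (fun v hv => hall v hv _)
  · push Not at hb
    set X : Finset V := Finset.univ.filter (fun v => ∃ p : G.Walk r v, Even p.length) with hXd
    set Y : Finset V := Finset.univ.filter (fun v => ∃ p : G.Walk r v, Odd p.length) with hYd
    have hX : ∀ v, v ∈ X ↔ ∃ p : G.Walk r v, Even p.length := by simp [hXd]
    have hY : ∀ v, v ∈ Y ↔ ∃ p : G.Walk r v, Odd p.length := by simp [hYd]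
    have hdis : Disjoint X Y := by
      rw [Finset.disjoint_left]
      intro v hv hv'
      obtain ⟨p, hp⟩ := (hX v).1 hv
      obtain ⟨p', hp'⟩ := (hY v).1 hv'
      have := hb v ⟨p, hp⟩ p'
      grind
    have hU : X ∪ Y = C := by
      ext v
      rw [Finset.mem_union, hX, hY]
      constructor
      · rintro (⟨p, _⟩ | ⟨p, _⟩) <;> exact hmemC v p
      · intro hv
        obtain ⟨p⟩ := hreach v hv
        rcases Nat.even_or_odd p.length with h | h
        · exact Or.inl ⟨p, h⟩
        · exact Or.inr ⟨p, h⟩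
    have hXY : ∀ u ∈ X, ∀ v, G.Adj u v → v ∈ Y := by
      intro u hu v huv
      obtain ⟨p, hp⟩ := (hX u).1 hu
      rw [hY]
      refine ⟨p.concat huv, ?_⟩
      rw [SimpleGraph.Walk.length_concat]
      exact hp.add_one
    have hYX : ∀ u ∈ Y, ∀ v, G.Adj u v → v ∈ X := by
      intro u hu v huv
      obtain ⟨p, hp⟩ := (hY u).1 hu
      rw [hX]
      refine ⟨p.concat huv, ?_⟩
      rw [SimpleGraph.Walk.length_concat]
      exact hp.add_one
    have hnb : ∀ v ∈ C, ∃ t, G.Adj v t := by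
      intro v hv
      obtain ⟨t, ht, hne⟩ := Finset.exists_mem_ne (by omega : 1 < C.card) v
      rw [hC] at hv ht
      have : G.Reachable v t := by
        rw [← SimpleGraph.ConnectedComponent.eq, hv, ht]
      obtain ⟨p⟩ := this
      cases p with
      | nil => exact absurd rfl hne
      | cons h p => exact ⟨_, h⟩
    have hrX : r ∈ X := (hX r).2 ⟨SimpleGraph.Walk.nil, by simp⟩
    have hrC : r ∈ C := (hC r).2 hr
    obtain ⟨t, hrt⟩ := hnb r hrC
    have htY : t ∈ Y := hXY r hrX t hrt
    have hcardU : X.card + Y.card = C.card := by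
      rw [← hU, Finset.card_union_of_disjoint hdis]
    have hgen : ∀ X' Y' : Finset V, Disjoint X' Y' → X' ∪ Y' = C →
        (∀ u ∈ Y', ∀ v, G.Adj u v → v ∈ X') → ¬ (X'.card = 1 ∧ Y'.card % 2 = 1) := by
      rintro X' Y' hd hu hadj ⟨c1, c2⟩
      have hcu : X'.card + Y'.card = C.card := by
        rw [← hu, Finset.card_union_of_disjoint hd]
      obtain ⟨s, rfl⟩ := Finset.card_eq_one.1 c1
      refine hstar (Y'.card / 2) (by omega) (star_iso G c s Y' _ ?_ ?_ (by omega) ?_)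
      · simpa using hd
      · intro v
        rw [SimpleGraph.ConnectedComponent.mem_supp_iff, ← hC, ← hu]
        simp
      · intro v hv t
        constructor
        · intro h
          simpa using hadj v hv t h
        · rintro rfl
          obtain ⟨t', ht'⟩ := hnb v (by rw [← hu]; exact Finset.mem_union_right _ hv)
          have : t' = t := by simpa using hadj v hv t' ht'
          exact this ▸ ht'
    refine ⟨X, Y, hdis, ?_, ?_, ?_⟩
    · intro v
      rw [hU, hC]
    · refine ⟨Finset.card_pos.2 ⟨r, hrX⟩, Finset.card_pos.2 ⟨t, htY⟩, by omega,
        hgen X Y hdis hU hYX, hgen Y X hdis.symm (by rw [Finset.union_comm, hU]) hXY⟩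
    · intro w hw
      rw [Finset.sum_union hdis]
      have e1 : ∑ v ∈ X, (Pi.single r (w v) - Pi.single v (w v) : V → A) ∈ wdegRange G A := by
        refine AddSubgroup.sum_mem _ (fun v hv => ?_)
        obtain ⟨p, hp⟩ := (hX v).1 hv
        exact (walk_mem G p _).1 hp
      have e2 : ∑ v ∈ Y, (Pi.single r (w v) + Pi.single v (w v) : V → A) ∈ wdegRange G A := by
        refine AddSubgroup.sum_mem _ (fun v hv => ?_)
        obtain ⟨p, hp⟩ := (hY v).1 hv
        exact (walk_mem G p _).2 hp
      have hs : ∀ S : Finset V, ∑ v ∈ S, (Pi.single r (w v) : V → A) =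
          Pi.single r (∑ v ∈ S, w v) := by
        intro S
        exact (map_sum (AddMonoidHom.single (fun _ : V => A) r) w S).symm
      rw [Finset.sum_sub_distrib, hs] at e1
      rw [Finset.sum_add_distrib, hs, ← hw] at e2
      convert AddSubgroup.sub_mem _ e2 e1 using 1
      abel

lemma exists_map_eq {V A : Type} [Nonempty A] (X : Finset V) (M : Multiset A)
    (h : M.card = X.card) : ∃ w : V → A, X.val.map w = M := by
  classical
  induction X using Finset.induction_on generalizing M with
  | empty =>
    refine ⟨fun _ => Classical.arbitrary A, ?_⟩
    simp at h
    simp [h]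
  | insert v X hv ih =>
    rw [Finset.card_insert_of_notMem hv] at h
    obtain ⟨a, ha⟩ := Multiset.card_pos_iff_exists_mem.1 (by omega : 0 < M.card)
    obtain ⟨M', rfl⟩ := Multiset.exists_cons_of_mem ha
    obtain ⟨w, hw⟩ := ih M' (by simpa using h)
    refine ⟨Function.update w v a, ?_⟩
    rw [Finset.insert_val_of_notMem hv, Multiset.map_cons, Function.update_self]
    congr 1
    rw [← hw]
    refine Multiset.map_congr rfl (fun x hx => ?_)
    rw [Function.update_of_ne]
    rintro rfl
    exact hv hx

lemma irregular_exists {V : Type} [Fintype V] (G : SimpleGraph V) (n k : ℕ)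
    (hn : Fintype.card V = n)
    (hcomp : ∀ c : G.ConnectedComponent, 3 ≤ c.supp.ncard)
    (hstar : ∀ (c : G.ConnectedComponent) (u : ℕ), 1 ≤ u →
      ¬ Nonempty (G.induce c.supp ≃g completeBipartiteGraph Unit (Fin (2 * u + 1))))
    (hk : k % 2 = 1) (hkn : k = n ∨ k = n + 1) :
    ∃ f : Sym2 V → ZMod k, G.IsIrregular f := by
  classical
  have h2 : ∀ a : ZMod k, ∃ b, a = b + b := by
    intro a
    refine ⟨((k + 1) / 2 : ℕ) * a, ?_⟩
    have h : (((k + 1) / 2 : ℕ) : ZMod k) + (((k + 1) / 2 : ℕ) : ZMod k) = 1 := by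
      rw [← Nat.cast_add, show (k + 1) / 2 + (k + 1) / 2 = k + 1 by omega]
      simp
    rw [← add_mul, h, one_mul]
  choose X Y hd hU hok hw using fun c => comp_exists G (ZMod k) h2 c (hcomp c) (hstar c)
  have hUf : ∀ c, X c ∪ Y c = Finset.univ.filter (fun v => G.connectedComponentMk v = c) := by
    intro c; ext v; rw [hU]; simp
  have hfib : ∀ {M : Type} [AddCommMonoid M] (F : V → M),
      ∑ c, ∑ v ∈ X c ∪ Y c, F v = ∑ v, F v := by
    intro M _ F
    rw [← Finset.sum_fiberwise Finset.univ G.connectedComponentMk F]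
    refine Finset.sum_congr rfl (fun c _ => Finset.sum_congr ?_ (fun _ _ => rfl))
    ext v
    rw [hU]
    simp
  have hsum : ∑ c, ((X c).card + (Y c).card) = n := by
    rw [← hn, ← Finset.card_univ,
      Finset.card_eq_sum_card_fiberwise (f := G.connectedComponentMk) (t := Finset.univ)
        (by intro v _; simp)]
    refine Finset.sum_congr rfl (fun c _ => ?_)
    rw [← Finset.card_union_of_disjoint (hd c), hUf]
  obtain ⟨MX, MY, hM, hnd⟩ := core_exists (fun c => (X c).card) (fun c => (Y c).card) hok n k
    hsum hk hkn
  choose wX hwX using fun c => exists_map_eq (X c) (MX c) (hM c).1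
  choose wY hwY using fun c => exists_map_eq (Y c) (MY c) (hM c).2.1
  set w : V → ZMod k := fun v => if v ∈ X (G.connectedComponentMk v) then
    wX (G.connectedComponentMk v) v else wY (G.connectedComponentMk v) v with hwdef
  have eX : ∀ c, (X c).val.map w = MX c := by
    intro c
    rw [← hwX c]
    refine Multiset.map_congr rfl (fun v hv => ?_)
    have hv' : v ∈ X c := hv
    have : G.connectedComponentMk v = c := (hU c v).1 (Finset.mem_union_left _ hv')
    simp [hwdef, this, hv']
  have eY : ∀ c, (Y c).val.map w = MY c := by
    intro c
    rw [← hwY c]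
    refine Multiset.map_congr rfl (fun v hv => ?_)
    have hv' : v ∈ Y c := hv
    have : G.connectedComponentMk v = c := (hU c v).1 (Finset.mem_union_right _ hv')
    have hv2 : v ∉ X c := Finset.disjoint_right.1 (hd c) hv'
    simp [hwdef, this, hv2]
  have hinj : Function.Injective w := by
    have hsing : ∀ S : Finset V, ∑ v ∈ S, ({w v} : Multiset (ZMod k)) = S.val.map w :=
      fun S => Multiset.bind_singleton S.val w
    have hall : ∑ c, (MX c + MY c) = (Finset.univ : Finset V).val.map w := by
      have e1 : ∀ c, MX c + MY c = ∑ v ∈ X c ∪ Y c, ({w v} : Multiset (ZMod k)) := by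
        intro c
        rw [Finset.sum_union (hd c), ← eX, ← eY, hsing, hsing]
      rw [Finset.sum_congr rfl (fun c _ => e1 c), hfib, hsing]
    rw [hall] at hnd
    intro u v huv
    exact Multiset.inj_on_of_nodup_map hnd u (Finset.mem_univ u) v (Finset.mem_univ v) huv
  have hmem : w ∈ wdegRange G (ZMod k) := by
    have e : w = ∑ c, ∑ v ∈ X c ∪ Y c, (Pi.single v (w v) : V → ZMod k) := by
      rw [hfib, Finset.univ_sum_single]
    rw [e]
    refine AddSubgroup.sum_mem _ (fun c _ => hw c w ?_)
    have := (hM c).2.2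
    rw [← eX, ← eY] at this
    exact this
  obtain ⟨f, hf⟩ := hmem
  refine ⟨f, ?_⟩
  rw [SimpleGraph.IsIrregular, hf]
  exact hinj

lemma wdeg_sum_two {V : Type} [Fintype V] (G : SimpleGraph V) (g : Sym2 V → ZMod 2) :
    ∑ v, G.wdeg g v = 0 := by
  classical
  simp only [SimpleGraph.wdeg]
  rw [Finset.sum_sigma']
  refine Finset.sum_involution (fun p _ => ⟨p.2, p.1⟩) ?_ ?_ ?_ ?_
  · rintro ⟨u, v⟩ _
    simp only [Sym2.eq_swap (a := v)]
    exact CharTwo.add_self_eq_zero _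
  · rintro ⟨u, v⟩ h _ he
    simp at h he
    exact h.ne he.2
  · rintro ⟨u, v⟩ h
    simp at h ⊢
    exact h.symm
  · rintro ⟨u, v⟩ h
    rfl

lemma not_irregular {V : Type} [Fintype V] (G : SimpleGraph V) (n : ℕ)
    (hn : Fintype.card V = n) (h4 : n % 4 = 2) (f : Sym2 V → ZMod n) : ¬ G.IsIrregular f := by
  intro hf
  have : NeZero n := ⟨by omega⟩
  have hb : Function.Bijective (G.wdeg f) := by
    rw [Fintype.bijective_iff_injective_and_card]
    exact ⟨hf, by rw [hn, ZMod.card]⟩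
  have hdvd : 2 ∣ n := by omega
  let φ : ZMod n →+* ZMod 2 := ZMod.castHom hdvd (ZMod 2)
  have h1 : ∑ v, φ (G.wdeg f v) = 0 := by
    rw [← wdeg_sum_two G (fun e => φ (f e))]
    refine Finset.sum_congr rfl (fun v _ => ?_)
    simp only [SimpleGraph.wdeg, map_sum]
  have h2 : ∑ v, φ (G.wdeg f v) = ∑ a : ZMod n, φ a := hb.sum_comp (fun a => φ a)
  have h3 : ∑ a : ZMod n, φ a = ∑ i ∈ Finset.range n, (i : ZMod 2) := by
    symm
    refine Finset.sum_bij' (fun i _ => (i : ZMod n)) (fun a _ => a.val) ?_ ?_ ?_ ?_ ?_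
    · simp
    · intro a _
      simpa using ZMod.val_lt a
    · intro i hi
      exact ZMod.val_cast_of_lt (Finset.mem_range.1 hi)
    · intro a _
      simp
    · intro i _
      simp
  rw [h2, h3, ← Nat.cast_sum, ZMod.natCast_eq_zero_iff] at h1
  have h5 := Finset.sum_range_id_mul_two n
  obtain ⟨t, ht⟩ := h1
  obtain ⟨s, rfl⟩ : ∃ s, n = 4 * s + 2 := ⟨n / 4, by omega⟩
  rw [ht, show 4 * s + 2 - 1 = 4 * s + 1 by omega] at h5
  have h6 : (4 * s + 2) * (4 * s + 1) = 4 * (4 * s * s + 3 * s) + 2 := by ring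
  omega

/-- For a finite simple graph `G` of order `n` with no component of order less than 3
and no component isomorphic to the star `K_{1, 2u+1}` for any integer `u ≥ 1`:
`k(G) = n` if `n` is odd, `k(G) = n + 1` if `n ≡ 2 (mod 4)`, and
`k(G) ≤ n + 1` if `n ≡ 0 (mod 4)`. -/
theorem modularEdgeGracefulness_of_no_odd_star_component
    {V : Type} [Fintype V] (G : SimpleGraph V) (n : ℕ) (hn : Fintype.card V = n)
    (hcomp : ∀ c : G.ConnectedComponent, 3 ≤ c.supp.ncard)
    (hstar : ∀ (c : G.ConnectedComponent) (u : ℕ), 1 ≤ u →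
      ¬ Nonempty (G.induce c.supp ≃g completeBipartiteGraph Unit (Fin (2 * u + 1)))) :
    (n % 2 = 1 → G.modularEdgeGracefulness = n) ∧
    (n % 4 = 2 → G.modularEdgeGracefulness = n + 1) ∧
    (n % 4 = 0 → G.modularEdgeGracefulness ≤ n + 1) := by
  have hle : ∀ k ∈ {k : ℕ | Fintype.card V ≤ k ∧ ∃ f : Sym2 V → ZMod k, G.IsIrregular f},
      n ≤ k := fun k hk => hn ▸ hk.1
  refine ⟨fun h => ?_, fun h => ?_, fun h => ?_⟩
  · have hm : n ∈ {k : ℕ | Fintype.card V ≤ k ∧ ∃ f : Sym2 V → ZMod k, G.IsIrregular f} :=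
      ⟨hn.le, irregular_exists G n n hn hcomp hstar h (Or.inl rfl)⟩
    exact le_antisymm (Nat.sInf_le hm) (hle _ (Nat.sInf_mem ⟨n, hm⟩))
  · have hm : n + 1 ∈ {k : ℕ | Fintype.card V ≤ k ∧ ∃ f : Sym2 V → ZMod k, G.IsIrregular f} :=
      ⟨by omega, irregular_exists G n (n + 1) hn hcomp hstar (by omega) (Or.inr rfl)⟩
    refine le_antisymm (Nat.sInf_le hm) ?_
    have hs := Nat.sInf_mem ⟨n + 1, hm⟩
    refine Nat.lt_of_le_of_ne (hle _ hs) ?_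
    intro he
    rw [SimpleGraph.modularEdgeGracefulness] at he
    rw [← he] at hs
    obtain ⟨_, f, hf⟩ := hs
    exact not_irregular G n hn h f hf
  · exact Nat.sInf_le ⟨by omega,
      irregular_exists G n (n + 1) hn hcomp hstar (by omega) (Or.inr rfl)⟩
end

section
/- Let G be a finite simple graph of order n having no connected component of order less than 3 and having no component isomorphic to the star K_{1, 2u+1} for any integer u ≥ 1. Then for every odd integer t ≥ k(G) there exists a ℤ_t-irregular labeling of G. -/
namespace IrregAux

open SimpleGraph

/-- Two-fold Skolem sequence of order `r`. -/
lemma skolem (r : ℕ) : ∃ p q : ℕ → ℕ, ∀ k l, 1 ≤ k → k ≤ r → 1 ≤ l → l ≤ r →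
    (p k + k < 4 * r ∧ q k + k < 4 * r ∧ p k ≠ p l + l ∧ q k ≠ q l + l ∧
    (k ≠ l → p k ≠ p l ∧ q k ≠ q l ∧ p k + k ≠ p l + l ∧ q k + k ≠ q l + l) ∧
    p k ≠ q l ∧ p k ≠ q l + l ∧ p k + k ≠ q l ∧ p k + k ≠ q l + l) := by
  rcases Nat.even_or_odd' r with ⟨j, rfl | rfl⟩
  · -- even blocks centred at `j` and `3 * j`; odd blocks after `4 * j` and `6 * j`
    refine ⟨fun k => if k % 2 = 0 then j - k / 2 else 5 * j - 1 - k / 2,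
      fun k => if k % 2 = 0 then (if k = 2 * j then j else 3 * j - k / 2)
        else 7 * j - 1 - k / 2, ?_⟩
    intro k l hk hk' hl hl'
    dsimp only
    split_ifs <;> omega
  · refine ⟨fun k => if k % 2 = 0 then j - k / 2 else 5 * j + 2 - k / 2,
      fun k => if k % 2 = 0 then 3 * j + 1 - k / 2 else
        (if k = 2 * j + 1 then j else 7 * j + 3 - k / 2), ?_⟩
    intro k l hk hk' hl hl'
    dsimp only
    split_ifs <;> omega

set_option maxHeartbeats 1000000 in
/-- Natural number version of the supply of values. -/
lemma supplyNat (t T P : ℕ) (ht : Odd t) (h : 3 * T + 2 * P ≤ t) :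
    ∃ (x y z a b : ℕ → ℕ),
      (∀ i < T, x i < t ∧ y i < t ∧ z i < t ∧ (x i + y i = z i ∨ x i + y i = z i + t) ∧
        x i ≠ y i ∧ x i ≠ z i ∧ y i ≠ z i) ∧
      (∀ i < P, a i < t ∧ b i < t ∧ a i + b i = t ∧ a i ≠ b i) ∧
      (∀ i < T, ∀ j < T, i ≠ j → x i ≠ x j ∧ x i ≠ y j ∧ x i ≠ z j ∧ y i ≠ y j ∧ y i ≠ z j ∧
        z i ≠ z j) ∧
      (∀ i < P, ∀ j < P, i ≠ j → a i ≠ a j ∧ a i ≠ b j ∧ b i ≠ b j) ∧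
      (∀ i < T, ∀ j < P, x i ≠ a j ∧ x i ≠ b j ∧ y i ≠ a j ∧ y i ≠ b j ∧ z i ≠ a j ∧
        z i ≠ b j) := by
  obtain ⟨r, e, he, hT⟩ : ∃ r e, e ≤ 1 ∧ T = 2 * r + e := ⟨T / 2, T % 2, by omega, by omega⟩
  obtain ⟨d, hd⟩ : ∃ d, t = 6 * r + 1 + 2 * d := by
    obtain ⟨m, hm⟩ := ht
    exact ⟨m - 3 * r, by omega⟩
  have hP : P + e ≤ d := by omega
  obtain ⟨p, q, hpq⟩ := skolem r
  have hr : ∀ k, 1 ≤ k → k ≤ r → p k + k < 4 * r ∧ q k + k < 4 * r := fun k h1 h2 =>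
    ⟨(hpq k k h1 h2 h1 h2).1, (hpq k k h1 h2 h1 h2).2.1⟩
  refine ⟨fun i => if i < r then i + 1 else if i < 2 * r then t - (i - r + 1) else r + d,
    fun i => if i < r then r + d + 1 + p (i + 1) else
      if i < 2 * r then r + d + 1 + q (i - r + 1) + (i - r + 1) else t - (r + d),
    fun i => if i < r then r + d + 1 + p (i + 1) + (i + 1) else
      if i < 2 * r then r + d + 1 + q (i - r + 1) else 0,
    fun i => r + 1 + i, fun i => t - (r + 1 + i), ?_, ?_, ?_, ?_, ?_⟩
  · intro i hi
    have h1 := hr (i + 1)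
    have h2 := hr (i - r + 1)
    dsimp only
    split_ifs with c1 c2
    · replace h1 := h1 (by omega) (by omega)
      clear h2
      omega
    · replace h2 := h2 (by omega) (by omega)
      clear h1
      omega
    · omega
  · intro i hi
    dsimp only
    omega
  · intro i hi j hj hij
    dsimp only
    split_ifs with c1 c2 c3 c4 c5 c6
    · have R1 := hr (i + 1) (by omega) (by omega)
      have R2 := hr (j + 1) (by omega) (by omega)
      have N := fun _ : Unit => hpq (i + 1) (j + 1) (by omega) (by omega) (by omega) (by omega)
      have N' := fun _ : Unit => hpq (j + 1) (i + 1) (by omega) (by omega) (by omega) (by omega)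
      refine ⟨?_, ?_, ?_, ?_, ?_, ?_⟩ <;> first
        | omega
        | exact fun hh => (N ()).2.2.1 (by omega)
        | exact fun hh => (N' ()).2.2.1 (by omega)
        | exact fun hh => ((N ()).2.2.2.2.1 (by omega)).1 (by omega)
        | exact fun hh => ((N ()).2.2.2.2.1 (by omega)).2.2.1 (by omega)
    · have R1 := hr (i + 1) (by omega) (by omega)
      have R2 := hr (j - r + 1) (by omega) (by omega)
      have N := fun _ : Unit => hpq (i + 1) (j - r + 1) (by omega) (by omega) (by omega) (by omega)
      refine ⟨?_, ?_, ?_, ?_, ?_, ?_⟩ <;> first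
        | omega
        | exact fun hh => (N ()).2.2.2.2.2.1 (by omega)
        | exact fun hh => (N ()).2.2.2.2.2.2.1 (by omega)
        | exact fun hh => (N ()).2.2.2.2.2.2.2.1 (by omega)
    · have R1 := hr (i + 1) (by omega) (by omega)
      refine ⟨?_, ?_, ?_, ?_, ?_, ?_⟩ <;> first
        | omega
    · have R1 := hr (i - r + 1) (by omega) (by omega)
      have R2 := hr (j + 1) (by omega) (by omega)
      have N := fun _ : Unit => hpq (j + 1) (i - r + 1) (by omega) (by omega) (by omega) (by omega)
      refine ⟨?_, ?_, ?_, ?_, ?_, ?_⟩ <;> first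
        | omega
        | exact fun hh => (N ()).2.2.2.2.2.1 (by omega)
        | exact fun hh => (N ()).2.2.2.2.2.2.1 (by omega)
        | exact fun hh => (N ()).2.2.2.2.2.2.2.1 (by omega)
        | exact fun hh => (N ()).2.2.2.2.2.2.2.2 (by omega)
    · have R1 := hr (i - r + 1) (by omega) (by omega)
      have R2 := hr (j - r + 1) (by omega) (by omega)
      have N := fun _ : Unit => hpq (i - r + 1) (j - r + 1) (by omega) (by omega) (by omega) (by omega)
      have N' := fun _ : Unit => hpq (j - r + 1) (i - r + 1) (by omega) (by omega) (by omega) (by omega)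
      refine ⟨?_, ?_, ?_, ?_, ?_, ?_⟩ <;> first
        | omega
        | exact fun hh => (N ()).2.2.2.1 (by omega)
        | exact fun hh => (N' ()).2.2.2.1 (by omega)
        | exact fun hh => ((N ()).2.2.2.2.1 (by omega)).2.1 (by omega)
        | exact fun hh => ((N ()).2.2.2.2.1 (by omega)).2.2.2 (by omega)
    · have R1 := hr (i - r + 1) (by omega) (by omega)
      refine ⟨?_, ?_, ?_, ?_, ?_, ?_⟩ <;> first
        | omega
    · have R1 := hr (j + 1) (by omega) (by omega)
      refine ⟨?_, ?_, ?_, ?_, ?_, ?_⟩ <;> first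
        | omega
    · have R1 := hr (j - r + 1) (by omega) (by omega)
      refine ⟨?_, ?_, ?_, ?_, ?_, ?_⟩ <;> first
        | omega
    · refine ⟨?_, ?_, ?_, ?_, ?_, ?_⟩ <;> first
        | omega
  · intro i hi j hj hij
    dsimp only
    omega
  · intro i hi j hj
    have h1 := hr (i + 1)
    have h2 := hr (i - r + 1)
    dsimp only
    split_ifs with c1 c2
    · replace h1 := h1 (by omega) (by omega)
      clear h2
      omega
    · replace h2 := h2 (by omega) (by omega)
      clear h1
      omega
    · omega

variable {V : Type}

/-- Even walk relation. -/
def EvW (G : SimpleGraph V) (u v : V) : Prop := ∃ p : G.Walk u v, Even p.length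

/-- Odd walk relation. -/
def OdW (G : SimpleGraph V) (u v : V) : Prop := ∃ p : G.Walk u v, Odd p.length

section walks
variable {G : SimpleGraph V} {u v w : V}

lemma EvW.refl (u : V) : EvW G u u := ⟨Walk.nil, by simp⟩
lemma EvW.symm (h : EvW G u v) : EvW G v u := by
  obtain ⟨p, hp⟩ := h; exact ⟨p.reverse, by simpa using hp⟩
lemma OdW.symm (h : OdW G u v) : OdW G v u := by
  obtain ⟨p, hp⟩ := h; exact ⟨p.reverse, by simpa using hp⟩
lemma EvW.ee (h : EvW G u v) (h' : EvW G v w) : EvW G u w := by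
  obtain ⟨p, hp⟩ := h; obtain ⟨q, hq⟩ := h'
  exact ⟨p.append q, by rw [Walk.length_append]; exact hp.add hq⟩
lemma EvW.eo (h : EvW G u v) (h' : OdW G v w) : OdW G u w := by
  obtain ⟨p, hp⟩ := h; obtain ⟨q, hq⟩ := h'
  exact ⟨p.append q, by rw [Walk.length_append]; exact hp.add_odd hq⟩
lemma OdW.oe (h : OdW G u v) (h' : EvW G v w) : OdW G u w := (h'.symm.eo h.symm).symm
lemma OdW.oo (h : OdW G u v) (h' : OdW G v w) : EvW G u w := by
  obtain ⟨p, hp⟩ := h; obtain ⟨q, hq⟩ := h'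
  exact ⟨p.append q, by rw [Walk.length_append]; exact hp.add_odd hq⟩
lemma OdW.of_adj (h : G.Adj u v) : OdW G u v := ⟨h.toWalk, by simp⟩

end walks

section realize
variable [Fintype V] [DecidableEq V] (G : SimpleGraph V) (A : Type) [AddCommGroup A]

/-- The subgroup of realizable weight functions. -/
def W : AddSubgroup (V → A) where
  carrier := {w | ∃ f : Sym2 V → A, G.wdeg f = w}
  zero_mem' := ⟨0, by funext v; simp [SimpleGraph.wdeg]⟩
  add_mem' := by
    rintro _ _ ⟨f, rfl⟩ ⟨g, rfl⟩
    exact ⟨f + g, by funext v; simp [SimpleGraph.wdeg, Finset.sum_add_distrib]⟩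
  neg_mem' := by
    rintro _ ⟨f, rfl⟩
    exact ⟨-f, by funext v; simp [SimpleGraph.wdeg]⟩

variable {G A}

lemma W_adj {u v : V} (h : G.Adj u v) (a : A) :
    (Pi.single u a + Pi.single v a : V → A) ∈ W G A := by
  refine ⟨Pi.single s(u, v) a, ?_⟩
  have hne := h.ne
  funext x
  simp only [SimpleGraph.wdeg, Pi.add_apply, Pi.single_apply]
  by_cases hx : x = u
  · subst hx
    rw [Finset.sum_eq_single v]
    · simp [hne]
    · intro b _ hb
      simp [hb, hne]
    · intro hb
      simp [h] at hb
  · by_cases hx' : x = v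
    · subst hx'
      rw [Finset.sum_eq_single u]
      · simp [hx, Sym2.eq_swap]
      · intro b _ hb
        simp [hb, hx]
      · intro hb
        simp [h.symm] at hb
    · simp [hx, hx']

lemma W_walk {u v : V} (p : G.Walk u v) :
    (Even p.length → ∀ a : A, (Pi.single u a - Pi.single v a : V → A) ∈ W G A) ∧
    (Odd p.length → ∀ a : A, (Pi.single u a + Pi.single v a : V → A) ∈ W G A) := by
  induction p with
  | nil => simp [(W G A).zero_mem]
  | @cons u v w h p ih =>
    constructor
    · intro hp a
      have h2 := ih.2 (by rw [Walk.length_cons] at hp; grind) a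
      have := (W G A).sub_mem (W_adj h a) h2
      convert this using 1
      abel
    · intro hp a
      have h2 := ih.1 (by rw [Walk.length_cons] at hp; grind) a
      have := (W G A).sub_mem (W_adj h a) h2
      convert this using 1
      abel

lemma W_ev {u v : V} (h : EvW G u v) (a : A) :
    (Pi.single u a - Pi.single v a : V → A) ∈ W G A := by
  obtain ⟨p, hp⟩ := h; exact (W_walk p).1 hp a
lemma W_od {u v : V} (h : OdW G u v) (a : A) :
    (Pi.single u a + Pi.single v a : V → A) ∈ W G A := by
  obtain ⟨p, hp⟩ := h; exact (W_walk p).2 hp a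

end realize

/-- Decomposition of a vertex set into `T` triples and `P` pairs. -/
inductive Dec [DecidableEq V] (G : SimpleGraph V) : Finset V → ℕ → ℕ → Prop
  | empty : Dec G ∅ 0 0
  | pair {S T P u v} : Dec G S T P → u ∉ S → v ∉ S → u ≠ v → EvW G u v →
      Dec G (insert u (insert v S)) T (P + 1)
  | triple {S T P u v w} : Dec G S T P → u ∉ S → v ∉ S → w ∉ S → u ≠ v → u ≠ w → v ≠ w →
      OdW G u w → OdW G v w → Dec G (insert u (insert v (insert w S))) (T + 1) P

section dec
variable [DecidableEq V] {G : SimpleGraph V}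

lemma Dec.card {S : Finset V} {T P : ℕ} (h : Dec G S T P) : S.card = 3 * T + 2 * P := by
  induction h with
  | empty => simp
  | pair h hu hv huv e ih =>
    rw [Finset.card_insert_of_notMem (by simp [hu, huv]), Finset.card_insert_of_notMem hv]
    omega
  | triple h hu hv hw huv huw hvw e e' ih =>
    rw [Finset.card_insert_of_notMem (by simp [hu, huv, huw]),
      Finset.card_insert_of_notMem (by simp [hv, hvw]), Finset.card_insert_of_notMem hw]
    omega

lemma Dec.union {S S' : Finset V} {T P T' P' : ℕ} (h : Dec G S T P) (h' : Dec G S' T' P')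
    (hd : Disjoint S S') : Dec G (S ∪ S') (T + T') (P + P') := by
  induction h with
  | empty => simpa using h'
  | @pair S T P u v h hu hv huv e ih =>
    simp only [Finset.disjoint_insert_left] at hd
    have := (ih hd.2.2).pair (u := u) (v := v) (by simp [hu, hd.1]) (by simp [hv, hd.2.1]) huv e
    rw [Finset.insert_union, Finset.insert_union]
    convert this using 1
    omega
  | @triple S T P u v w h hu hv hw huv huw hvw e e' ih =>
    simp only [Finset.disjoint_insert_left] at hd
    have := (ih hd.2.2.2).triple (u := u) (v := v) (w := w) (by simp [hu, hd.1])
      (by simp [hv, hd.2.1]) (by simp [hw, hd.2.2.1]) huv huw hvw e e'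
    rw [Finset.insert_union, Finset.insert_union, Finset.insert_union]
    convert this using 1
    omega

lemma Dec.assign [Fintype V] {A : Type} [AddCommGroup A] {T₀ P₀ : ℕ} (x y z a b : ℕ → A)
    (h1 : ∀ i < T₀, x i + y i = z i ∧ x i ≠ y i ∧ x i ≠ z i ∧ y i ≠ z i)
    (h2 : ∀ i < P₀, a i + b i = 0 ∧ a i ≠ b i)
    (h3 : ∀ i < T₀, ∀ j < T₀, i ≠ j → x i ≠ x j ∧ x i ≠ y j ∧ x i ≠ z j ∧ y i ≠ y j ∧
      y i ≠ z j ∧ z i ≠ z j)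
    (h4 : ∀ i < P₀, ∀ j < P₀, i ≠ j → a i ≠ a j ∧ a i ≠ b j ∧ b i ≠ b j)
    (h5 : ∀ i < T₀, ∀ j < P₀, x i ≠ a j ∧ x i ≠ b j ∧ y i ≠ a j ∧ y i ≠ b j ∧ z i ≠ a j ∧
        z i ≠ b j)
    {S : Finset V} {T P : ℕ} (h : Dec G S T P) : T ≤ T₀ → P ≤ P₀ →
    ∃ w ∈ W G A, (∀ v ∉ S, w v = 0) ∧ (∀ u ∈ S, ∀ v ∈ S, w u = w v → u = v) ∧
      ∀ v ∈ S, (∃ i < T, w v = x i ∨ w v = y i ∨ w v = z i) ∨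
        (∃ i < P, w v = a i ∨ w v = b i) := by
  induction h with
  | empty => intro _ _; exact ⟨0, (W G A).zero_mem, by simp⟩
  | @pair S T P u v h hu hv huv e ih =>
    intro hT hP
    obtain ⟨w, hw, hw0, hinj, hval⟩ := ih hT (by omega)
    have hp := h2 P (by omega)
    have key : ∀ s ∈ S, w s ≠ a P ∧ w s ≠ b P := by
      intro s hs
      rcases hval s hs with ⟨i, hi, hh⟩ | ⟨i, hi, hh⟩
      · have := h5 i (by omega) P (by omega)
        grind
      · have := h4 i (by omega) P (by omega) (by omega)
        have := h4 P (by omega) i (by omega) (by omega)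
        grind
    have hmem := (W G A).add_mem hw (W_ev e (a P))
    set w' : V → A := w + (Pi.single u (a P) - Pi.single v (a P)) with hw'
    have eu : w' u = a P := by simp [hw', hw0 u hu, huv]
    have ev : w' v = b P := by
      have : b P = - a P := by rw [eq_neg_iff_add_eq_zero, add_comm]; exact hp.1
      simp [hw', hw0 v hv, huv, this]
    have eo : ∀ s, s ≠ u → s ≠ v → w' s = w s := by
      intro s h1 h2; simp [hw', h1, h2]
    refine ⟨w', hmem, ?_, ?_, ?_⟩
    · intro s hs
      simp only [Finset.mem_insert, not_or] at hs
      rw [eo s hs.1 hs.2.1, hw0 s hs.2.2]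
    · intro s hs s' hs' 
      have eS : ∀ s ∈ S, w' s = w s := by
        intro s hs
        apply eo <;> (rintro rfl; contradiction)
      simp only [Finset.mem_insert] at hs hs'
      clear_value w'
      clear ih hval h1 h2 h3 h4 h5 hw0 hw' hmem eo
      grind
    · intro s hs
      simp only [Finset.mem_insert] at hs
      rcases hs with rfl | rfl | hs
      · exact Or.inr ⟨P, by omega, Or.inl eu⟩
      · exact Or.inr ⟨P, by omega, Or.inr ev⟩
      · rw [eo s (by rintro rfl; exact hu hs) (by rintro rfl; exact hv hs)]
        rcases hval s hs with h | ⟨i, hi, h⟩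
        · exact Or.inl h
        · exact Or.inr ⟨i, by omega, h⟩
  | @triple S T P u v t h hu hv ht huv hut hvt e e' ih =>
    intro hT hP
    obtain ⟨w, hw, hw0, hinj, hval⟩ := ih (by omega) hP
    have hp := h1 T (by omega)
    have key : ∀ s ∈ S, w s ≠ x T ∧ w s ≠ y T ∧ w s ≠ z T := by
      intro s hs
      rcases hval s hs with ⟨i, hi, hh⟩ | ⟨i, hi, hh⟩
      · have := h3 i (by omega) T (by omega) (by omega)
        have := h3 T (by omega) i (by omega) (by omega)
        grind
      · have := h5 T (by omega) i (by omega)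
        grind
    have hmem := (W G A).add_mem ((W G A).add_mem hw (W_od e (x T))) (W_od e' (y T))
    set w' : V → A := w + (Pi.single u (x T) + Pi.single t (x T)) +
      (Pi.single v (y T) + Pi.single t (y T)) with hw'
    have eu : w' u = x T := by simp [hw', hw0 u hu, huv, hut]
    have ev : w' v = y T := by simp [hw', hw0 v hv, huv, hvt]
    have et : w' t = z T := by simp [hw', hw0 t ht, hut, hvt, hp.1]
    have eo : ∀ s, s ≠ u → s ≠ v → s ≠ t → w' s = w s := by
      intro s h1 h2 h3; simp [hw', h1, h2, h3]
    refine ⟨w', hmem, ?_, ?_, ?_⟩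
    · intro s hs
      simp only [Finset.mem_insert, not_or] at hs
      rw [eo s hs.1 hs.2.1 hs.2.2.1, hw0 s hs.2.2.2]
    · intro s hs s' hs'
      have eS : ∀ s ∈ S, w' s = w s := by
        intro s hs
        apply eo <;> (rintro rfl; contradiction)
      simp only [Finset.mem_insert] at hs hs'
      clear_value w'
      clear ih hval h1 h2 h3 h4 h5 hw0 hw' hmem eo
      grind
    · intro s hs
      simp only [Finset.mem_insert] at hs
      rcases hs with rfl | rfl | rfl | hs
      · exact Or.inl ⟨T, by omega, Or.inl eu⟩
      · exact Or.inl ⟨T, by omega, Or.inr (Or.inl ev)⟩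
      · exact Or.inl ⟨T, by omega, Or.inr (Or.inr et)⟩
      · rw [eo s (by rintro rfl; exact hu hs) (by rintro rfl; exact hv hs)
          (by rintro rfl; exact ht hs)]
        rcases hval s hs with ⟨i, hi, h⟩ | h
        · exact Or.inl ⟨i, by omega, h⟩
        · exact Or.inr h

lemma Dec.pairs (q : ℕ) : ∀ S : Finset V, S.card = 2 * q →
    (∀ u ∈ S, ∀ v ∈ S, EvW G u v) → Dec G S 0 q := by
  induction q with
  | zero =>
    intro S hS _
    have : S = ∅ := by simpa using hS
    subst this; exact Dec.empty
  | succ q ih =>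
    intro S hS hE
    obtain ⟨u, hu⟩ : S.Nonempty := Finset.card_pos.1 (by omega)
    have c1 := Finset.card_erase_of_mem hu
    obtain ⟨v, hv⟩ : (S.erase u).Nonempty := Finset.card_pos.1 (by omega)
    have c2 := Finset.card_erase_of_mem hv
    have := ih ((S.erase u).erase v) (by omega)
      (fun a ha b hb => hE a (by simp at ha; exact ha.2.2) b (by simp at hb; exact hb.2.2))
    have hv' := hv
    rw [Finset.mem_erase] at hv'
    have h2 := this.pair (u := u) (v := v) (by simp) (by simp) hv'.1.symm (hE u hu v hv'.2)
    rwa [Finset.insert_erase hv, Finset.insert_erase hu] at h2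

lemma Dec.pairs' (S : Finset V) (h : Even S.card) (hE : ∀ u ∈ S, ∀ v ∈ S, EvW G u v) :
    ∃ T P, Dec G S T P := by
  obtain ⟨q, hq⟩ := h
  exact ⟨0, q, Dec.pairs q S (by omega) hE⟩

lemma Dec.union' {S S' : Finset V} (h : ∃ T P, Dec G S T P) (h' : ∃ T P, Dec G S' T P)
    (hd : Disjoint S S') : ∃ T P, Dec G (S ∪ S') T P := by
  obtain ⟨T, P, h⟩ := h
  obtain ⟨T', P', h'⟩ := h'
  exact ⟨_, _, h.union h' hd⟩

/-- remove a triple with two vertices in `X` and one in `Y`. -/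
lemma Dec.remTriple {X Y : Finset V} (hd : Disjoint X Y) (hX : 2 ≤ X.card) (hY : 1 ≤ Y.card)
    (hO : ∀ u ∈ X, ∀ v ∈ Y, OdW G u v)
    (H : ∀ X' ⊆ X, ∀ Y' ⊆ Y, X'.card + 2 = X.card → Y'.card + 1 = Y.card →
      ∃ T P, Dec G (X' ∪ Y') T P) : ∃ T P, Dec G (X ∪ Y) T P := by
  obtain ⟨u, hu⟩ : X.Nonempty := Finset.card_pos.1 (by omega)
  have c1 := Finset.card_erase_of_mem hu
  obtain ⟨v, hv⟩ : (X.erase u).Nonempty := Finset.card_pos.1 (by omega)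
  have c2 := Finset.card_erase_of_mem hv
  obtain ⟨w, hw⟩ : Y.Nonempty := Finset.card_pos.1 (by omega)
  have c3 := Finset.card_erase_of_mem hw
  have hv' := hv
  rw [Finset.mem_erase] at hv'
  have hdd := Finset.disjoint_left.1 hd
  obtain ⟨T, P, h⟩ := H ((X.erase u).erase v)
    ((Finset.erase_subset _ _).trans (Finset.erase_subset _ _)) (Y.erase w)
    (Finset.erase_subset _ _) (by omega) (by omega)
  have := h.triple (u := u) (v := v) (w := w) (by simp [hdd hu]) (by simp [hdd hv'.2])
    (by have : w ∉ X := fun h => hdd h hw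
        simp [this]) hv'.1.symm (by rintro rfl; exact hdd hu hw)
    (by rintro rfl; exact hdd hv'.2 hw) (hO u hu w hw) (hO v hv'.2 w hw)
  refine ⟨T + 1, P, ?_⟩
  convert this using 1
  ext s
  simp only [Finset.mem_union, Finset.mem_insert, Finset.mem_erase]
  by_cases s = u <;> by_cases s = v <;> by_cases s = w <;> grind

lemma Dec.bip {X Y : Finset V} (hd : Disjoint X Y)
    (hX : ∀ u ∈ X, ∀ v ∈ X, EvW G u v) (hY : ∀ u ∈ Y, ∀ v ∈ Y, EvW G u v)
    (hO : ∀ u ∈ X, ∀ v ∈ Y, OdW G u v)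
    (hc : (Even X.card ∧ Even Y.card) ∨ (Even X.card ∧ 2 ≤ X.card ∧ Odd Y.card) ∨
      (Odd X.card ∧ Odd Y.card ∧ 3 ≤ X.card ∧ 3 ≤ Y.card)) : ∃ T P, Dec G (X ∪ Y) T P := by
  have hev : ∀ X' ⊆ X, ∀ Y' ⊆ Y, Even X'.card → Even Y'.card → ∃ T P, Dec G (X' ∪ Y') T P := by
    intro X' hX' Y' hY' e e'
    exact Dec.union' (Dec.pairs' X' e fun u hu v hv => hX u (hX' hu) v (hX' hv))
      (Dec.pairs' Y' e' fun u hu v hv => hY u (hY' hu) v (hY' hv))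
      (Finset.disjoint_of_subset_left hX' (Finset.disjoint_of_subset_right hY' hd))
  rcases hc with ⟨e, e'⟩ | ⟨e, e2, e'⟩ | ⟨e, e', e3, e4⟩
  · exact hev X subset_rfl Y subset_rfl e e'
  · refine Dec.remTriple hd e2 e'.pos hO ?_
    intro X' hX' Y' hY' c c'
    exact hev X' hX' Y' hY' (by grind) (by grind)
  · refine Dec.remTriple hd (by omega) (by omega) hO ?_
    intro X' hX' Y' hY' c c'
    have := Dec.remTriple (G := G) (X := Y') (Y := X')
      (Finset.disjoint_of_subset_left hX' (Finset.disjoint_of_subset_right hY' hd)).symm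
      (by omega) (by omega) (fun u hu v hv => (hO v (hX' hv) u (hY' hu)).symm) ?_
    · rwa [Finset.union_comm] at this
    · intro Y'' hY'' X'' hX'' d d'
      rw [Finset.union_comm]
      exact hev X'' (hX''.trans hX') Y'' (hY''.trans hY') (by grind) (by grind)

end dec

lemma star_aux [Fintype V] (G : SimpleGraph V) (c : G.ConnectedComponent) (x : V)
    (hx : x ∈ c.supp) (h1 : ∀ v, EvW G x v → v = x) (h2 : Even c.supp.ncard)
    (h3 : 3 ≤ c.supp.ncard)
    (hstar : ∀ (u : ℕ), 1 ≤ u →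
      ¬ Nonempty (G.induce c.supp ≃g completeBipartiteGraph Unit (Fin (2 * u + 1)))) : False := by
  classical
  obtain ⟨q, hq⟩ := h2
  have hod : ∀ b ∈ c.supp, b ≠ x → OdW G x b := by
    intro b hb hbx
    have : G.Reachable x b := ConnectedComponent.exact (hx.trans hb.symm)
    obtain ⟨p⟩ := this
    rcases Nat.even_or_odd p.length with e | e
    · exact absurd (h1 b ⟨p, e⟩) hbx
    · exact ⟨p, e⟩
  have hadj : ∀ b ∈ c.supp, b ≠ x → G.Adj x b := by
    intro b hb hbx
    obtain ⟨p, hp⟩ := (hod b hb hbx).symm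
    cases p with
    | nil => simp at hp
    | @cons _ n _ h p =>
      have : n = x := h1 n ((hod b hb hbx).oo (OdW.of_adj h))
      subst this; exact h.symm
  have hnadj : ∀ b ∈ c.supp, b ≠ x → ∀ b', b' ≠ x → ¬ G.Adj b b' := by
    intro b hb hbx b' hb' h
    exact hb' (h1 b' ((hod b hb hbx).oo (OdW.of_adj h)))
  apply hstar (q - 2 + 1) (by omega)
  let B := {s : c.supp // s ≠ ⟨x, hx⟩}
  have hB : Fintype.card B = 2 * (q - 2 + 1) + 1 := by
    have : Fintype.card B = Fintype.card c.supp - 1 := by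
      rw [Fintype.card_subtype_compl, Fintype.card_subtype_eq]
    rw [this, ← Nat.card_eq_fintype_card, Nat.card_coe_set_eq]
    omega
  let e := Fintype.equivFinOfCardEq hB
  refine ⟨⟨⟨fun s => if h : s = ⟨x, hx⟩ then Sum.inl () else Sum.inr (e ⟨s, h⟩),
    fun s => Sum.elim (fun _ => ⟨x, hx⟩) (fun i => (e.symm i).1) s, ?_, ?_⟩, ?_⟩⟩
  · intro s
    by_cases h : s = ⟨x, hx⟩ <;> simp [h]
  · rintro (s | i)
    · simp
    · have := (e.symm i).2
      simp [this]
  · intro s s'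
    simp only [Equiv.coe_fn_mk, comap_adj, Function.Embedding.subtype_apply]
    by_cases h : s = ⟨x, hx⟩ <;> by_cases h' : s' = ⟨x, hx⟩
    · simp [h, h']
    · have : G.Adj x s' := hadj s' s'.2 (fun hh => h' (Subtype.ext hh))
      simp [h, h', this]
    · have : G.Adj s x := (hadj s s.2 (fun hh => h (Subtype.ext hh))).symm
      simp [h, h', this]
    · have := hnadj s s.2 (fun hh => h (Subtype.ext hh)) s' (fun hh => h' (Subtype.ext hh))
      simp [h, h', this]

lemma comp_dec [Fintype V] [DecidableEq V] (G : SimpleGraph V) (c : G.ConnectedComponent)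
    (h3 : 3 ≤ c.supp.ncard)
    (hstar : ∀ (u : ℕ), 1 ≤ u →
      ¬ Nonempty (G.induce c.supp ≃g completeBipartiteGraph Unit (Fin (2 * u + 1))))
    (S : Finset V) (hS : ∀ v, v ∈ S ↔ v ∈ c.supp) : ∃ T P, Dec G S T P := by
  classical
  have hSc : (S : Set V) = c.supp := by ext v; simp [hS]
  have hcard : S.card = c.supp.ncard := by rw [← hSc, Set.ncard_coe_finset]
  obtain ⟨x, hx⟩ := c.nonempty_supp
  have hreach : ∀ v ∈ S, EvW G x v ∨ OdW G x v := by
    intro v hv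
    have hv := (hS v).1 hv
    have : G.Reachable x v := ConnectedComponent.exact (hx.trans hv.symm)
    obtain ⟨p⟩ := this
    rcases Nat.even_or_odd p.length with e | e
    · exact Or.inl ⟨p, e⟩
    · exact Or.inr ⟨p, e⟩
  have hmemS : ∀ v, G.Reachable x v → v ∈ S := by
    intro v hv
    rw [hS]
    exact (ConnectedComponent.sound hv.symm).trans hx
  have hxS : x ∈ S := (hS x).2 hx
  by_cases hodd : OdW G x x
  · -- non-bipartite
    have hO : ∀ v ∈ S, OdW G x v := by
      intro v hv
      rcases hreach v hv with h | h
      · exact hodd.oe h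
      · exact h
    have hE : ∀ u ∈ S, ∀ v ∈ S, EvW G u v := fun u hu v hv => (hO u hu).symm.oo (hO v hv)
    have hOO : ∀ u ∈ S, ∀ v ∈ S, OdW G u v := fun u hu v hv => (hE u hu x hxS).eo (hO v hv)
    rcases Nat.even_or_odd S.card with e | e
    · exact Dec.pairs' S e hE
    · have hc := Finset.card_erase_of_mem hxS
      have := Dec.bip (G := G) (X := S.erase x) (Y := {x}) (by simp)
        (fun u hu v hv => hE u (Finset.mem_of_mem_erase hu) v (Finset.mem_of_mem_erase hv))
        (by simp [EvW.refl])
        (fun u hu v hv => hOO u (Finset.mem_of_mem_erase hu) v (by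
          rw [Finset.mem_singleton] at hv; rwa [hv]))
        (Or.inr (Or.inl ⟨by grind, by omega, by simp⟩))
      rwa [Finset.union_comm, ← Finset.insert_eq, Finset.insert_erase hxS] at this
  · set X := S.filter (fun v => EvW G x v) with hXd
    set Y := S.filter (fun v => OdW G x v) with hYd
    have hU : X ∪ Y = S := by
      ext v
      simp only [hXd, hYd, Finset.mem_union, Finset.mem_filter]
      have := hreach v
      tauto
    have hd : Disjoint X Y := by
      rw [Finset.disjoint_left]
      intro v hv hv'
      simp only [hXd, hYd, Finset.mem_filter] at hv hv'
      exact hodd (hv.2.eo hv'.2.symm)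
    have hEX : ∀ u ∈ X, ∀ v ∈ X, EvW G u v := by
      intro u hu v hv
      simp only [hXd, Finset.mem_filter] at hu hv
      exact hu.2.symm.ee hv.2
    have hEY : ∀ u ∈ Y, ∀ v ∈ Y, EvW G u v := by
      intro u hu v hv
      simp only [hYd, Finset.mem_filter] at hu hv
      exact hu.2.symm.oo hv.2
    have hOXY : ∀ u ∈ X, ∀ v ∈ Y, OdW G u v := by
      intro u hu v hv
      simp only [hXd, hYd, Finset.mem_filter] at hu hv
      exact hu.2.symm.eo hv.2
    have hxX : x ∈ X := by simp [hXd, hxS, EvW.refl]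
    have hYne : Y.Nonempty := by
      have c1 := Finset.card_erase_of_mem hxS
      obtain ⟨v, hv⟩ : (S.erase x).Nonempty := Finset.card_pos.1 (by omega)
      rw [Finset.mem_erase] at hv
      have : G.Reachable x v := ConnectedComponent.exact (hx.trans ((hS v).1 hv.2).symm)
      obtain ⟨p⟩ := this
      cases p with
      | nil => exact absurd rfl hv.1
      | @cons _ n _ h p =>
        exact ⟨n, by
          simp only [hYd, Finset.mem_filter]
          exact ⟨hmemS n h.reachable, OdW.of_adj h⟩⟩
    have hXpos : 0 < X.card := Finset.card_pos.2 ⟨x, hxX⟩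
    have hYpos : 0 < Y.card := Finset.card_pos.2 hYne
    have hsum : X.card + Y.card = S.card := by rw [← hU, Finset.card_union_of_disjoint hd]
    rw [← hU]
    rcases Nat.even_or_odd X.card with e | e <;> rcases Nat.even_or_odd Y.card with e' | e'
    · exact Dec.bip hd hEX hEY hOXY (Or.inl ⟨e, e'⟩)
    · exact Dec.bip hd hEX hEY hOXY (Or.inr (Or.inl ⟨e, by grind, e'⟩))
    · rw [Finset.union_comm]
      exact Dec.bip hd.symm hEY hEX (fun u hu v hv => (hOXY v hv u hu).symm)
        (Or.inr (Or.inl ⟨e', by grind, e⟩))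
    · have hev : Even c.supp.ncard := by rw [← hcard, ← hsum]; exact e.add_odd e'
      have hX1 : X.card ≠ 1 := by
        intro h
        obtain ⟨y, hy⟩ := Finset.card_eq_one.1 h
        refine star_aux G c x hx ?_ hev h3 hstar
        intro v hv
        have hvX : v ∈ X := by
          simp only [hXd, Finset.mem_filter]
          obtain ⟨p, hp⟩ := hv
          exact ⟨hmemS v p.reachable, p, hp⟩
        rw [hy, Finset.mem_singleton] at hvX hxX
        rw [hvX, hxX]
      have hY1 : Y.card ≠ 1 := by
        intro h
        obtain ⟨y, hy⟩ := Finset.card_eq_one.1 h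
        have hyY : y ∈ Y := by simp [hy]
        have hyY' := hyY
        simp only [hYd, Finset.mem_filter] at hyY'
        refine star_aux G c y ((hS y).1 hyY'.1) ?_ hev h3 hstar
        intro v hv
        have hvY : v ∈ Y := by
          simp only [hYd, Finset.mem_filter]
          have := hyY'.2.oe hv
          obtain ⟨p, hp⟩ := this
          exact ⟨hmemS v p.reachable, p, hp⟩
        rwa [hy, Finset.mem_singleton] at hvY
      exact Dec.bip hd hEX hEY hOXY (Or.inr (Or.inr ⟨e, e', by grind, by grind⟩))

lemma full_dec [Fintype V] [DecidableEq V] (G : SimpleGraph V)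
    (hcomp : ∀ c : G.ConnectedComponent, 3 ≤ c.supp.ncard)
    (hstar : ∀ (c : G.ConnectedComponent) (u : ℕ), 1 ≤ u →
      ¬ Nonempty (G.induce c.supp ≃g completeBipartiteGraph Unit (Fin (2 * u + 1)))) :
    ∃ T P, Dec G Finset.univ T P := by
  classical
  have key : ∀ C : Finset G.ConnectedComponent,
      ∃ T P, Dec G (Finset.univ.filter (fun v => G.connectedComponentMk v ∈ C)) T P := by
    intro C
    induction C using Finset.induction_on with
    | empty => exact ⟨0, 0, by simpa using Dec.empty⟩
    | insert c C hc ih =>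
      have := Dec.union' (comp_dec G c (hcomp c) (hstar c)
        (Finset.univ.filter (fun v => G.connectedComponentMk v = c)) (by simp)) ih (by
          rw [Finset.disjoint_left]
          intro v hv hv'
          simp only [Finset.mem_filter, Finset.mem_univ, true_and] at hv hv'
          rw [hv] at hv'
          exact hc hv')
      rw [← Finset.filter_or] at this
      simpa using this
  haveI : Fintype G.ConnectedComponent := Fintype.ofFinite _
  simpa using key Finset.univ

lemma main [Fintype V] (G : SimpleGraph V)
    (hcomp : ∀ c : G.ConnectedComponent, 3 ≤ c.supp.ncard)
    (hstar : ∀ (c : G.ConnectedComponent) (u : ℕ), 1 ≤ u →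
      ¬ Nonempty (G.induce c.supp ≃g completeBipartiteGraph Unit (Fin (2 * u + 1))))
    (t : ℕ) (ht : Odd t) (hn : Fintype.card V ≤ t) :
    ∃ f : Sym2 V → ZMod t, G.IsIrregular f := by
  classical
  obtain ⟨T, P, h⟩ := full_dec G hcomp hstar
  have hc := h.card
  rw [Finset.card_univ] at hc
  obtain ⟨x, y, z, a, b, h1, h2, h3, h4, h5⟩ := supplyNat t T P ht (by omega)
  have cast_ne : ∀ m n : ℕ, m < t → n < t → m ≠ n → (m : ZMod t) ≠ (n : ZMod t) := by
    intro m n hm hn hmn h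
    rw [ZMod.natCast_eq_natCast_iff', Nat.mod_eq_of_lt hm, Nat.mod_eq_of_lt hn] at h
    exact hmn h
  obtain ⟨w, ⟨f, hf⟩, -, hinj, -⟩ := h.assign (A := ZMod t) (T₀ := T) (P₀ := P)
    (fun i => x i) (fun i => y i) (fun i => z i) (fun i => a i) (fun i => b i)
    (by
      intro i hi
      obtain ⟨e1, e2, e3, e4, e5, e6, e7⟩ := h1 i hi
      refine ⟨?_, cast_ne _ _ e1 e2 e5, cast_ne _ _ e1 e3 e6, cast_ne _ _ e2 e3 e7⟩
      rcases e4 with e | e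
      · have := congrArg (Nat.cast : ℕ → ZMod t) e
        simpa using this
      · have := congrArg (Nat.cast : ℕ → ZMod t) e
        simpa using this)
    (by
      intro i hi
      obtain ⟨e1, e2, e3, e4⟩ := h2 i hi
      refine ⟨?_, cast_ne _ _ e1 e2 e4⟩
      have := congrArg (Nat.cast : ℕ → ZMod t) e3
      simpa using this)
    (by
      intro i hi j hj hij
      obtain ⟨i1, i2, i3, -⟩ := h1 i hi
      obtain ⟨j1, j2, j3, -⟩ := h1 j hj
      obtain ⟨e1, e2, e3, e4, e5, e6⟩ := h3 i hi j hj hij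
      refine ⟨?_, ?_, ?_, ?_, ?_, ?_⟩ <;> apply cast_ne <;> assumption)
    (by
      intro i hi j hj hij
      obtain ⟨i1, i2, -⟩ := h2 i hi
      obtain ⟨j1, j2, -⟩ := h2 j hj
      obtain ⟨e1, e2, e3⟩ := h4 i hi j hj hij
      refine ⟨?_, ?_, ?_⟩ <;> apply cast_ne <;> assumption)
    (by
      intro i hi j hj
      obtain ⟨i1, i2, i3, -⟩ := h1 i hi
      obtain ⟨j1, j2, -⟩ := h2 j hj
      obtain ⟨e1, e2, e3, e4, e5, e6⟩ := h5 i hi j hj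
      refine ⟨?_, ?_, ?_, ?_, ?_, ?_⟩ <;> apply cast_ne <;> assumption)
    le_rfl le_rfl
  refine ⟨f, ?_⟩
  intro u v huv
  rw [hf] at huv
  exact hinj u (Finset.mem_univ _) v (Finset.mem_univ _) huv

end IrregAux

/-- Let `G` be a finite simple graph of order `n` with no component of order less
than 3 and no component isomorphic to the star `K_{1, 2u+1}` for any integer `u ≥ 1`.
Then for every odd integer `t ≥ k(G)` there exists a `ℤ_t`-irregular labeling of `G`. -/
theorem exists_zmod_irregular_labeling_of_no_odd_star_component
    {V : Type} [Fintype V] (G : SimpleGraph V)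
    (hcomp : ∀ c : G.ConnectedComponent, 3 ≤ c.supp.ncard)
    (hstar : ∀ (c : G.ConnectedComponent) (u : ℕ), 1 ≤ u →
      ¬ Nonempty (G.induce c.supp ≃g completeBipartiteGraph Unit (Fin (2 * u + 1)))) :
    ∀ t : ℕ, Odd t → G.modularEdgeGracefulness ≤ t →
      ∃ f : Sym2 V → ZMod t, G.IsIrregular f := by
  intro t ht hk
  have hne : {k : ℕ | Fintype.card V ≤ k ∧ ∃ f : Sym2 V → ZMod k, G.IsIrregular f}.Nonempty :=
    ⟨2 * Fintype.card V + 1, by omega, IrregAux.main G hcomp hstar _ ⟨_, rfl⟩ (by omega)⟩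
  exact IrregAux.main G hcomp hstar t ht ((Nat.sInf_mem hne).1.trans hk)
end

section
/- Let s = r_1 + r_2 + ... + r_q be a partition of the positive odd integer s, where r_1 ≥ 1 and r_i ≥ 2 for i = 2, 3, ..., q, and let 𝒢 be an Abelian group of order s. Then the set 𝒢 can be partitioned into pairwise disjoint subsets A_1, A_2, ..., A_q such that for every 1 ≤ i ≤ q, |A_i| = r_i and ∑_{a ∈ A_i} a = 0. -/
/-- The conditions on a (possibly hooked) Skolem sequence of order `k`: the pair with
difference `i` occupies the positions `a i` and `a i + i`. -/
def ZSPSkolem (k : ℕ) (a : ℕ → ℕ) : Prop :=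
  (∀ i, 1 ≤ i → i ≤ k → 1 ≤ a i ∧ a i + i ≤ 2 * k + 1) ∧
  (∀ i j, 1 ≤ i → i ≤ k → 1 ≤ j → j ≤ k → i < j →
    a i ≠ a j ∧ a i + i ≠ a j + j ∧ a i ≠ a j + j ∧ a j ≠ a i + i) ∧
  ((∀ i, 1 ≤ i → i ≤ k → a i ≠ 2 * k ∧ a i + i ≠ 2 * k) ∨
    (∀ i, 1 ≤ i → i ≤ k → a i + i ≠ 2 * k + 1))

set_option maxHeartbeats 2000000 in
theorem zsp_skolem0 (s : ℕ) (hs : 2 ≤ s) : ∃ a, ZSPSkolem (4 * s) a := by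
  refine ⟨fun i => if i % 2 = 0 then 6 * s - i / 2 else if i = 1 then s else
    if i = 2 * s - 1 then 2 * s else if i = 2 * s + 1 then s - 1 else
    if i = 4 * s - 1 then 2 * s + 1 else
    if i < 2 * s then s + 1 + (2 * s - 1 - i) / 2 else (4 * s - 1 - i) / 2, ?_, ?_, Or.inr ?_⟩
  · intro i h1 h2
    dsimp only
    split_ifs <;> omega
  · intro i j h1 h2 h3 h4 h5
    dsimp only
    split_ifs <;> omega
  · intro i h1 h2
    dsimp only
    split_ifs <;> omega

set_option maxHeartbeats 2000000 in
theorem zsp_skolem1 (s : ℕ) (hs : 2 ≤ s) : ∃ a, ZSPSkolem (4 * s + 1) a := by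
  refine ⟨fun i => if i % 2 = 0 then 6 * s + 2 - i / 2 else if i = 1 then s + 1 else
    if i = 2 * s - 1 then 2 * s + 2 else if i = 4 * s + 1 then 2 * s + 1 else
    if i < 2 * s then s + 2 + (2 * s - 1 - i) / 2 else (4 * s + 1 - i) / 2, ?_, ?_, Or.inr ?_⟩
  · intro i h1 h2
    dsimp only
    split_ifs <;> omega
  · intro i j h1 h2 h3 h4 h5
    dsimp only
    split_ifs <;> omega
  · intro i h1 h2
    dsimp only
    split_ifs <;> omega

set_option maxHeartbeats 2000000 in
theorem zsp_skolem2 (s : ℕ) (hs : 1 ≤ s) : ∃ a, ZSPSkolem (4 * s + 2) a := by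
  refine ⟨fun i => if i = 4 * s + 2 then 4 * s + 3 else
    if i % 2 = 0 then (4 * s + 2 - i) / 2 else if i = 1 then 7 * s + 3 else
    if i = 4 * s + 1 then 2 * s + 1 else if i = 2 * s + 1 then 4 * s + 2 else
    if i < 2 * s then 5 * s + 2 + (2 * s + 1 - i) / 2 else 4 * s + 3 + (4 * s + 1 - i) / 2,
    ?_, ?_, Or.inl ?_⟩
  · intro i h1 h2
    dsimp only
    split_ifs <;> omega
  · intro i j h1 h2 h3 h4 h5
    dsimp only
    split_ifs <;> omega
  · intro i h1 h2
    dsimp only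
    split_ifs <;> omega

set_option maxHeartbeats 2000000 in
theorem zsp_skolem3 (s : ℕ) (hs : 2 ≤ s) : ∃ a, ZSPSkolem (4 * s - 1) a := by
  refine ⟨fun i => if i = 4 * s - 2 then 2 * s + 1 else
    if i % 2 = 0 then 4 * s + (4 * s - 2 - i) / 2 else if i = 1 then s else
    if i = 2 * s - 1 then 2 * s else if i = 2 * s + 1 then s - 1 else
    if i = 4 * s - 1 then 4 * s else
    if i < 2 * s then s + 1 + (2 * s - 1 - i) / 2 else (4 * s - 1 - i) / 2, ?_, ?_, Or.inl ?_⟩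
  · intro i h1 h2
    dsimp only
    split_ifs <;> omega
  · intro i j h1 h2 h3 h4 h5
    dsimp only
    split_ifs <;> omega
  · intro i h1 h2
    dsimp only
    split_ifs <;> omega

theorem zsp_skolem (k : ℕ) : ∃ a, ZSPSkolem k a := by
  by_cases h : k ≤ 5
  · have key : ∀ (l : List ℕ),
      ((∀ i ∈ Finset.Icc 1 k, 1 ≤ l.getD i 0 ∧ l.getD i 0 + i ≤ 2 * k + 1) ∧
      (∀ i ∈ Finset.Icc 1 k, ∀ j ∈ Finset.Icc 1 k, i < j →
        l.getD i 0 ≠ l.getD j 0 ∧ l.getD i 0 + i ≠ l.getD j 0 + j ∧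
        l.getD i 0 ≠ l.getD j 0 + j ∧ l.getD j 0 ≠ l.getD i 0 + i) ∧
      ((∀ i ∈ Finset.Icc 1 k, l.getD i 0 ≠ 2 * k ∧ l.getD i 0 + i ≠ 2 * k) ∨
        (∀ i ∈ Finset.Icc 1 k, l.getD i 0 + i ≠ 2 * k + 1))) → ∃ a, ZSPSkolem k a := by
      rintro l ⟨h1, h2, h3⟩
      refine ⟨fun i => l.getD i 0, fun i a b => h1 i (Finset.mem_Icc.2 ⟨a, b⟩),
        fun i j a b c d e => h2 i (Finset.mem_Icc.2 ⟨a, b⟩) j (Finset.mem_Icc.2 ⟨c, d⟩) e, ?_⟩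
      rcases h3 with h3 | h3
      · exact Or.inl fun i a b => h3 i (Finset.mem_Icc.2 ⟨a, b⟩)
      · exact Or.inr fun i a b => h3 i (Finset.mem_Icc.2 ⟨a, b⟩)
    interval_cases k
    · exact key [] (by decide)
    · exact key [0, 1] (by decide)
    · exact key [0, 1, 3] (by decide)
    · exact key [0, 2, 5, 1] (by decide)
    · exact key [0, 7, 2, 3, 1] (by decide)
    · exact key [0, 9, 2, 5, 3, 1] (by decide)
  · obtain ⟨s, hs⟩ : ∃ s, s = k / 4 := ⟨_, rfl⟩
    have h4 : k % 4 = 0 ∨ k % 4 = 1 ∨ k % 4 = 2 ∨ k % 4 = 3 := by omega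
    rcases h4 with h4 | h4 | h4 | h4
    · have := zsp_skolem0 s (by omega)
      rwa [show 4 * s = k by omega] at this
    · have := zsp_skolem1 s (by omega)
      rwa [show 4 * s + 1 = k by omega] at this
    · have := zsp_skolem2 s (by omega)
      rwa [show 4 * s + 2 = k by omega] at this
    · have := zsp_skolem3 (s + 1) (by omega)
      rwa [show 4 * (s + 1) - 1 = k by omega] at this

/-- A family of zero-sum triples which, together with their negatives, are pairwise disjoint. -/
structure ZSPGood {G : Type} [AddCommGroup G] {ι : Type} (f : ι → Fin 3 → G) : Prop where
  sum : ∀ i, f i 0 + f i 1 + f i 2 = 0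
  inj : ∀ i j k l, f i j = f k l → i = k ∧ j = l
  neg : ∀ i j k l, f i j ≠ - f k l

/-- The group has a good family of the largest possible size. -/
def ZSPHas (G : Type) [AddCommGroup G] : Prop :=
  ∃ (ι : Type) (_ : Finite ι) (f : ι → Fin 3 → G), ZSPGood f ∧ Nat.card G ≤ 6 * Nat.card ι + 5

theorem zsp_equiv {G H : Type} [AddCommGroup G] [AddCommGroup H] (e : G ≃+ H) (h : ZSPHas H) :
    ZSPHas G := by
  obtain ⟨ι, hι, f, hf, hc⟩ := h
  refine ⟨ι, hι, fun i j => e.symm (f i j), ⟨?_, ?_, ?_⟩, ?_⟩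
  · intro i
    rw [← map_add, ← map_add, hf.sum, map_zero]
  · intro i j i' j' h
    exact hf.inj _ _ _ _ (e.symm.injective h)
  · intro i j i' j' h
    rw [← map_neg] at h
    exact hf.neg _ _ _ _ (e.symm.injective h)
  · rwa [Nat.card_congr e.toEquiv]

theorem zsp_cyclic (n : ℕ) (hn : n % 2 = 1) : ZSPHas (ZMod n) := by
  obtain ⟨k, hk⟩ : ∃ k, k = (n - 1) / 6 := ⟨_, rfl⟩
  obtain ⟨a, h1, h2, h3⟩ := zsp_skolem k
  have hk1 : 6 * k + 1 ≤ n := by omega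
  let g : Fin k → Fin 3 → ℕ := fun i => ![i + 1, k + a (i + 1), k + a (i + 1) + (i + 1)]
  have hg1 : ∀ i j, 1 ≤ g i j ∧ g i j ≤ 3 * k + 1 := by
    intro i j
    have := i.2
    have := h1 (i + 1) (by omega) (by omega)
    fin_cases j <;> simp [g] <;> omega
  have hg2 : ∀ i j i' j', g i j = g i' j' → i = i' ∧ j = j' := by
    intro i j i' j' h
    have b1 := i.2
    have b2 := i'.2
    have e1 := h1 (i + 1) (by omega) (by omega)
    have e2 := h1 (i' + 1) (by omega) (by omega)
    have e3 := h2 (i + 1) (i' + 1) (by omega) (by omega) (by omega) (by omega)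
    have e4 := h2 (i' + 1) (i + 1) (by omega) (by omega) (by omega) (by omega)
    rcases lt_trichotomy i i' with hl | hl | hl
    · have hl' : (i : ℕ) < i' := hl
      have e3 := e3 (by omega)
      exfalso
      fin_cases j <;> fin_cases j' <;> simp [g] at h <;> omega
    · subst hl
      refine ⟨rfl, ?_⟩
      fin_cases j <;> fin_cases j' <;> simp [g] at h ⊢ <;> omega
    · have hl' : (i' : ℕ) < i := hl
      have e4 := e4 (by omega)
      exfalso
      fin_cases j <;> fin_cases j' <;> simp [g] at h <;> omega
  have hg3 : ∀ i j i' j', g i j + g i' j' ≠ n := by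
    have key : (∀ i j, g i j ≠ 3 * k) ∨ (∀ i j, g i j ≠ 3 * k + 1) := by
      rcases h3 with h3 | h3
      · left
        intro i j
        have b1 := i.2
        have e1 := h1 (i + 1) (by omega) (by omega)
        have e3 := h3 (i + 1) (by omega) (by omega)
        fin_cases j <;> simp [g] <;> omega
      · right
        intro i j
        have b1 := i.2
        have e1 := h1 (i + 1) (by omega) (by omega)
        have e3 := h3 (i + 1) (by omega) (by omega)
        fin_cases j <;> simp [g] <;> omega
    intro i j i' j' h
    have e1 := hg1 i j
    have e2 := hg1 i' j'
    rcases key with h3 | h3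
    · have := h3 i j
      have := h3 i' j'
      omega
    · have := h3 i j
      have := h3 i' j'
      omega
  have hp : ∀ i j i' j', (g i j : ZMod n) = g i' j' → i = i' ∧ j = j' := by
    intro i j i' j' h
    apply hg2
    have e1 := hg1 i j
    have e2 := hg1 i' j'
    rw [ZMod.natCast_eq_natCast_iff'] at h
    have b1 := i.2
    rwa [Nat.mod_eq_of_lt (by omega), Nat.mod_eq_of_lt (by omega)] at h
  have hm : ∀ i j i' j', (g i j : ZMod n) ≠ - g i' j' := by
    intro i j i' j' h
    have h' : ((g i j + g i' j' : ℕ) : ZMod n) = 0 := by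
      push_cast
      rw [h]; ring
    rw [ZMod.natCast_eq_zero_iff] at h'
    obtain ⟨c, hc⟩ := h'
    have e1 := hg1 i j
    have e2 := hg1 i' j'
    have b1 := i.2
    have := hg3 i j i' j'
    have hc1 : c = 0 ∨ c = 1 ∨ 2 ≤ c := by omega
    rcases hc1 with rfl | rfl | hc1
    · omega
    · omega
    · have := Nat.mul_le_mul_left n hc1
      omega
  let f : Fin k → Fin 3 → ZMod n := fun i => ![(g i 0 : ZMod n), g i 1, - g i 2]
  have hf : ∀ i j, (f i j = g i j ∧ j ≠ 2) ∨ (f i j = - g i j ∧ j = 2) := by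
    intro i j
    fin_cases j <;> simp [f]
  refine ⟨Fin k, inferInstance, f, ⟨?_, ?_, ?_⟩, ?_⟩
  · intro i
    simp [f, g]
    ring
  · intro i j i' j' h
    rcases hf i j with ⟨h1, _⟩ | ⟨h1, _⟩ <;> rcases hf i' j' with ⟨h2, _⟩ | ⟨h2, _⟩
    · exact hp _ _ _ _ (by rw [← h1, ← h2, h])
    · exact absurd (by rw [← h1, ← h2, h]) (hm i j i' j')
    · exact absurd (by rw [← h1, ← h2, h]) (hm i' j' i j)
    · exact hp _ _ _ _ (neg_injective (by rw [← h1, ← h2, h]))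
  · intro i j i' j' h
    rcases hf i j with ⟨h1, h3⟩ | ⟨h1, h3⟩ <;> rcases hf i' j' with ⟨h2, h4⟩ | ⟨h2, h4⟩
    · exact absurd (by rw [← h1, ← h2, h]) (hm i j i' j')
    · have := hp i j i' j' (by rw [← h1, h, h2, neg_neg])
      exact h3 (this.2.trans h4)
    · have := hp i j i' j' (neg_injective (by rw [← h1, h, h2]))
      exact h4 (this.2.symm.trans h3)
    · exact hm i j i' j' (by rw [← h2, ← neg_neg (f i' j'), ← h, h1, neg_neg])
  · rw [Nat.card_zmod, Nat.card_fin]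
    omega

theorem zsp_two {G : Type} [AddCommGroup G] [Finite G] (ho : Odd (Nat.card G)) (x : G)
    (h : x + x = 0) : x = 0 := by
  have h1 : addOrderOf x ∣ 2 := addOrderOf_dvd_of_nsmul_eq_zero (by rw [two_nsmul, h])
  have h2 := addOrderOf_dvd_natCard x
  have h3 : addOrderOf x ∣ 1 := by
    rw [← Nat.Coprime.gcd_eq_one (Nat.coprime_two_left.2 ho)]
    exact Nat.dvd_gcd h1 h2
  exact AddMonoid.addOrderOf_eq_one_iff.1 (Nat.dvd_one.1 h3)

theorem zsp_lift {G Q : Type} [AddCommGroup G] [AddCommGroup Q] [Finite G]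
    (ho : Odd (Nat.card G)) (π : G →+ Q) (hπ : Function.Surjective π)
    {ι : Type} [Finite ι] (f : ι → Fin 3 → Q) (hf : ZSPGood f) (K : AddSubgroup Q)
    (hK : ∀ i j, f i j ∉ K) (hc : Nat.card Q ≤ 6 * Nat.card ι + Nat.card K)
    (hh : ZSPHas (K.comap π)) : ZSPHas G := by
  obtain ⟨κ, hκ, g, hg, hgc⟩ := hh
  have : Finite Q := Finite.of_surjective π hπ
  let s : Q → G := Function.surjInv hπ
  have hs : ∀ x, π (s x) = x := Function.surjInv_eq hπ
  let f' : ι × π.ker → Fin 3 → G := fun p => ![s (f p.1 0) + p.2, s (f p.1 1) + p.2,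
    -(s (f p.1 0) + p.2 + (s (f p.1 1) + p.2))]
  have hf' : ∀ p j, π (f' p j) = f p.1 j := by
    intro p j
    have h0 : π p.2 = 0 := p.2.2
    have := hf.sum p.1
    fin_cases j
    · simp [f', hs, h0]
    · simp [f', hs, h0]
    · simp [f', hs, h0]
      rw [← sub_eq_zero, ← neg_eq_zero, ← this]
      abel
  refine ⟨(ι × π.ker) ⊕ κ, inferInstance, Sum.elim f' (fun i j => (g i j : G)), ⟨?_, ?_, ?_⟩, ?_⟩
  · rintro (p | i)
    · simp [f']
      abel
    · simpa using congrArg Subtype.val (hg.sum i)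
  · rintro (p | i) j (p' | i') j' h
    · simp only [Sum.elim_inl] at h
      have h1 := congrArg π h
      rw [hf', hf'] at h1
      obtain ⟨h2, rfl⟩ := hf.inj _ _ _ _ h1
      obtain ⟨p1, p2⟩ := p
      obtain ⟨q1, q2⟩ := p'
      simp only at h2
      subst h2
      refine ⟨?_, rfl⟩
      have : p2 = q2 := by
        fin_cases j
        · simpa [f'] using h
        · simpa [f'] using h
        · apply Subtype.ext
          simp [f'] at h
          rw [← sub_eq_zero]
          apply zsp_two ho
          rw [← sub_eq_zero] at h
          rw [← neg_eq_zero, ← h]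
          abel
      rw [this]
    · exfalso
      simp only [Sum.elim_inl, Sum.elim_inr] at h
      apply hK p.1 j
      rw [← hf', h]
      exact (g i' j').2
    · exfalso
      simp only [Sum.elim_inl, Sum.elim_inr] at h
      apply hK p'.1 j'
      rw [← hf', ← h]
      exact (g i j).2
    · simp only [Sum.elim_inr] at h
      have := hg.inj _ _ _ _ (Subtype.ext h)
      exact ⟨by rw [this.1], this.2⟩
  · rintro (p | i) j (p' | i') j' h
    · simp only [Sum.elim_inl] at h
      have h1 := congrArg π h
      rw [map_neg, hf', hf'] at h1
      exact hf.neg _ _ _ _ h1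
    · simp only [Sum.elim_inl, Sum.elim_inr] at h
      apply hK p.1 j
      rw [← hf', h, map_neg]
      exact K.neg_mem (g i' j').2
    · simp only [Sum.elim_inl, Sum.elim_inr] at h
      apply hK p'.1 j'
      rw [← hf', ← neg_neg (f' p' j'), ← h, map_neg]
      exact K.neg_mem (g i j).2
    · simp only [Sum.elim_inr] at h
      exact hg.neg _ _ _ _ (Subtype.ext (by simpa using h))
  · rw [Nat.card_sum, Nat.card_prod]
    have e1 : Nat.card Q * Nat.card π.ker = Nat.card G := by
      have := AddSubgroup.card_mul_index π.ker
      rw [AddSubgroup.index_ker, AddMonoidHom.range_eq_top.2 hπ, AddSubgroup.card_top] at this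
      rw [← this, mul_comm]
    have e2 : Nat.card (K.comap π) = Nat.card K * Nat.card π.ker := by
      have h1 := AddSubgroup.card_mul_index (K.comap π)
      rw [AddSubgroup.index_comap_of_surjective K hπ, ← e1, ← AddSubgroup.card_mul_index K] at h1
      have : 0 < K.index := Nat.pos_of_ne_zero AddSubgroup.index_ne_zero_of_finite
      apply Nat.eq_of_mul_eq_mul_right this
      rw [h1]; ring
    rw [e2] at hgc
    rw [← e1]
    nlinarith

theorem zsp_square {H : Type} [AddCommGroup H] [Finite H] (h2 : ∀ z : H, z + z = 0 → z = 0)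
    (h3 : ∀ z : H, z + z + z = 0 → z = 0) :
    ∃ (ι : Type) (_ : Finite ι) (f : ι → Fin 3 → H × H), ZSPGood f ∧ (∀ i j, f i j ≠ 0) ∧
      Nat.card (H × H) ≤ 6 * Nat.card ι + 1 := by
  let w : H × H → H × H := fun x => (-x.2, x.1 - x.2)
  have w3 : ∀ x, w (w (w x)) = x := by
    rintro ⟨a, b⟩
    simp [w]
    abel
  have ws : ∀ x, x + w x + w (w x) = 0 := by
    rintro ⟨a, b⟩
    simp [w]
    constructor <;> abel
  have wn : ∀ x, w (-x) = - w x := by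
    rintro ⟨a, b⟩
    simp [w, Prod.ext_iff]
    abel
  have n0 : ∀ x : H × H, x = - x → x = 0 := by
    rintro ⟨a, b⟩ h
    simp only [Prod.neg_mk, Prod.mk.injEq, Prod.mk_eq_zero] at h ⊢
    exact ⟨h2 _ (by nth_rw 1 [h.1]; abel), h2 _ (by nth_rw 1 [h.2]; abel)⟩
  have w0 : ∀ x, w x = x → x = 0 := by
    rintro ⟨a, b⟩ h
    simp only [w, Prod.mk.injEq, Prod.mk_eq_zero] at h ⊢
    obtain ⟨ha, hb⟩ := h
    have : b = 0 := h3 _ (by rw [← ha] at hb; grind)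
    refine ⟨?_, this⟩
    rw [← ha, this, neg_zero]
  have w0' : ∀ x, w x = - x → x = 0 := by
    intro x h
    apply n0
    have := w3 x
    rw [h, wn, h, neg_neg, h] at this
    exact this.symm
  have wz : ∀ x, w x = 0 → x = 0 := by
    intro x h
    have := w3 x
    rw [h] at this
    rw [← this]; simp [w]
  let R : H × H → H × H → Prop := fun x y =>
    y = x ∨ y = w x ∨ y = w (w x) ∨ y = - x ∨ y = - w x ∨ y = - w (w x)
  have Req : Equivalence R := by
    refine ⟨fun x => Or.inl rfl, ?_, ?_⟩
    · rintro x y (h | h | h | h | h | h) <;> subst h <;> simp only [R, wn, w3, neg_neg, true_or, or_true]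
    · rintro x y z (h | h | h | h | h | h) (h' | h' | h' | h' | h' | h') <;> subst h <;> subst h' <;>
        simp only [R, wn, w3, neg_neg, true_or, or_true]
  let S : Setoid (H × H) := ⟨R, Req⟩
  let ι := {c : Quotient S // c.out ≠ 0}
  let g : Fin 3 → H × H → H × H := fun j x => ![x, w x, w (w x)] j
  have hgR : ∀ j x, R x (g j x) ∧ R x (- g j x) := by
    intro j x
    fin_cases j <;> simp [g, R]
  have key : ∀ (c c' : ι) j j', (g j c.1.out = g j' c'.1.out ∨ g j c.1.out = - g j' c'.1.out) →
      c = c' := by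
    intro c c' j j' h
    apply Subtype.ext
    have : R c.1.out c'.1.out := by
      rcases h with h | h
      · exact Req.trans (hgR j _).1 (h ▸ Req.symm (hgR j' _).1)
      · exact Req.trans (hgR j _).1 (h ▸ Req.symm (hgR j' _).2)
    rw [← Quotient.out_eq c.1, ← Quotient.out_eq c'.1]
    exact Quotient.sound this
  refine ⟨ι, inferInstance, fun c j => g j c.1.out, ⟨?_, ?_, ?_⟩, ?_, ?_⟩
  · intro c
    exact ws _
  · intro c j c' j' h
    obtain rfl := key c c' j j' (Or.inl h)
    refine ⟨rfl, ?_⟩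
    have hc := c.2
    generalize c.1.out = x at *
    fin_cases j <;> fin_cases j' <;> simp [g] at h ⊢ <;> apply hc <;> grind
  · intro c j c' j' h
    obtain rfl := key c c' j j' (Or.inr h)
    have hc := c.2
    generalize c.1.out = x at *
    fin_cases j <;> fin_cases j' <;> simp [g] at h <;> apply hc <;> grind
  · intro c j h
    have hc := c.2
    generalize c.1.out = x at *
    fin_cases j <;> simp [g] at h <;> apply hc <;> grind
  · have hsurj : Function.Surjective (fun o : Option (ι × Fin 3 × Bool) =>
      match o with
      | none => (0 : H × H)
      | some (c, j, true) => g j c.1.out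
      | some (c, j, false) => - g j c.1.out) := by
      intro x
      by_cases hx : x = 0
      · exact ⟨none, hx.symm⟩
      have hr : R (Quotient.mk S x).out x := Quotient.exact (Quotient.out_eq (Quotient.mk S x))
      have h0 : (Quotient.mk S x).out ≠ 0 := by
        intro h
        rw [h] at hr
        have : w 0 = 0 := by simp [w]
        simp [R, this] at hr
        exact hx hr
      rcases hr with h | h | h | h | h | h
      · exact ⟨some (⟨_, h0⟩, 0, true), h.symm⟩
      · exact ⟨some (⟨_, h0⟩, 1, true), h.symm⟩
      · exact ⟨some (⟨_, h0⟩, 2, true), h.symm⟩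
      · exact ⟨some (⟨_, h0⟩, 0, false), h.symm⟩
      · exact ⟨some (⟨_, h0⟩, 1, false), h.symm⟩
      · exact ⟨some (⟨_, h0⟩, 2, false), h.symm⟩
    have := Nat.card_le_card_of_surjective _ hsurj
    rw [Finite.card_option, Nat.card_prod, Nat.card_prod] at this
    simp at this
    simp
    omega

theorem zsp_struct (G : Type) [AddCommGroup G] [Finite G] :
    (∃ n, Nonempty (G ≃+ ZMod n)) ∨
      ∃ p, p.Prime ∧ ∃ π : G →+ ZMod p × ZMod p, Function.Surjective π := by
  classical
  obtain ⟨ι, _, n, hn, ⟨e⟩⟩ := AddCommGroup.equiv_directSum_zmod_of_finite' G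
  let e' : G ≃+ (∀ i, ZMod (n i)) := e.trans (DirectSum.addEquivProd _)
  by_cases h : Pairwise (Function.onFun Nat.Coprime n)
  · left
    exact ⟨∏ i, n i, ⟨e'.trans (ZMod.prodEquivPi n h).symm.toAddEquiv⟩⟩
  · right
    simp only [Pairwise, not_forall, Function.onFun] at h
    obtain ⟨i, j, hij, hc⟩ := h
    obtain ⟨p, hp, hpi, hpj⟩ := Nat.Prime.not_coprime_iff_dvd.1 hc
    refine ⟨p, hp, (((ZMod.castHom hpi (ZMod p)).toAddMonoidHom.comp
      (Pi.evalAddMonoidHom _ i)).prod ((ZMod.castHom hpj (ZMod p)).toAddMonoidHom.comp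
      (Pi.evalAddMonoidHom _ j))).comp e'.toAddMonoidHom, ?_⟩
    rintro ⟨x, y⟩
    obtain ⟨x', rfl⟩ := ZMod.castHom_surjective hpi x
    obtain ⟨y', rfl⟩ := ZMod.castHom_surjective hpj y
    refine ⟨e'.symm (Function.update (Function.update 0 i x') j y'), ?_⟩
    simp [Function.update_of_ne hij]

theorem zsp_three : ∃ f : Unit → Fin 3 → ZMod 3 × ZMod 3, ZSPGood f ∧
    ∃ K : AddSubgroup (ZMod 3 × ZMod 3), (∀ i j, f i j ∉ K) ∧ Nat.card K = 3 := by
  refine ⟨fun _ => ![(1, 0), (0, 1), (2, 2)], ⟨?_, ?_, ?_⟩,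
    (AddMonoidHom.coprod (AddMonoidHom.id (ZMod 3)) (AddMonoidHom.id (ZMod 3))).ker, ?_, ?_⟩
  · decide
  · decide
  · decide
  · intro i j
    rw [AddMonoidHom.mem_ker]
    revert i j
    decide
  · have h := AddSubgroup.card_mul_index
      (AddMonoidHom.coprod (AddMonoidHom.id (ZMod 3)) (AddMonoidHom.id (ZMod 3))).ker
    rw [AddSubgroup.index_ker, AddMonoidHom.range_eq_top.2, AddSubgroup.card_top] at h
    · rw [Nat.card_prod, Nat.card_zmod] at h
      omega
    · intro x
      exact ⟨(x, 0), by simp⟩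

theorem zsp_has (N : ℕ) : ∀ (G : Type) [AddCommGroup G] [Finite G],
    Nat.card G = N → Odd (Nat.card G) → ZSPHas G := by
  induction N using Nat.strong_induction_on with
  | _ N ih =>
  intro G _ _ hN ho
  rcases zsp_struct G with ⟨n, ⟨e⟩⟩ | ⟨p, hp, π, hπ⟩
  · refine zsp_equiv e (zsp_cyclic n ?_)
    rw [Nat.card_congr e.toEquiv, Nat.card_zmod] at ho
    exact Nat.odd_iff.1 ho
  · have hsub : ∀ K : AddSubgroup (ZMod p × ZMod p), K ≠ ⊤ → ZSPHas (K.comap π) := by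
      intro K hK
      have hlt : Nat.card (K.comap π) < N := by
        rw [← hN]
        apply lt_of_le_of_ne
        · exact AddSubgroup.card_le_card_addGroup _
        · intro h
          have := AddSubgroup.eq_top_of_card_eq _ h
          apply hK
          rw [eq_top_iff]
          intro x _
          obtain ⟨y, rfl⟩ := hπ x
          have hy : y ∈ K.comap π := this ▸ AddSubgroup.mem_top y
          exact hy
      exact ih _ hlt _ rfl (Odd.of_dvd_nat ho (AddSubgroup.card_addSubgroup_dvd_card _))
    have : Fact p.Prime := ⟨hp⟩
    have hpd : p ∣ Nat.card G := by
      have h1 := AddSubgroup.card_range_dvd π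
      rw [AddMonoidHom.range_eq_top.2 hπ, AddSubgroup.card_top, Nat.card_prod, Nat.card_zmod] at h1
      exact dvd_trans (dvd_mul_left _ _) h1
    have hpo : Odd p := Odd.of_dvd_nat ho hpd
    by_cases h3 : p = 3
    · subst h3
      obtain ⟨f, hf, K, hK, hc⟩ := zsp_three
      refine zsp_lift ho π hπ f hf K hK ?_ (hsub K ?_)
      · rw [hc]; simp
      · rintro rfl
        exact hK () 0 (AddSubgroup.mem_top _)
    · have hcop : ∀ m : ℕ, m.Prime → p ≠ m → (m : ZMod p) ≠ 0 := by
        intro m hm hne h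
        rw [ZMod.natCast_eq_zero_iff] at h
        exact hne ((Nat.prime_dvd_prime_iff_eq hp hm).1 h)
      obtain ⟨ι, _, f, hf, hf0, hc⟩ := zsp_square (H := ZMod p) (by
          intro z hz
          have h2 := hcop 2 Nat.prime_two (by rintro rfl; exact absurd hpo (by decide))
          rw [← two_mul] at hz
          exact (mul_eq_zero.1 hz).resolve_left (by exact_mod_cast h2))
        (by
          intro z hz
          have h2 := hcop 3 Nat.prime_three h3
          have hz : (3 : ZMod p) * z = 0 := by rw [← hz]; ring
          exact (mul_eq_zero.1 hz).resolve_left (by exact_mod_cast h2))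
      refine zsp_lift ho π hπ f hf ⊥ (fun i j => by simpa using hf0 i j) (by simpa using hc)
        (hsub ⊥ bot_ne_top)

theorem zsp_sym_sum {G : Type} [AddCommGroup G] [Finite G] (ho : Odd (Nat.card G))
    (S : Finset G) (hS : ∀ x ∈ S, -x ∈ S) : ∑ x ∈ S, x = 0 := by
  apply zsp_two ho
  have : ∑ x ∈ S, x = ∑ x ∈ S, -x :=
    Finset.sum_bij' (fun x _ => -x) (fun x _ => -x) hS hS (by simp) (by simp) (by simp)
  nth_rw 2 [this]
  rw [Finset.sum_neg_distrib, add_neg_cancel]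

theorem zsp_sym_sub {G : Type} [AddCommGroup G] [Finite G] [DecidableEq G]
    (ho : Odd (Nat.card G)) (S : Finset G) (hS : ∀ x ∈ S, -x ∈ S) (h0 : (0 : G) ∉ S) (m : ℕ)
    (hm : 2 * m ≤ S.card) : ∃ T ⊆ S, (∀ x ∈ T, -x ∈ T) ∧ T.card = 2 * m := by
  induction m with
  | zero => exact ⟨∅, by simp, by simp, by simp⟩
  | succ m ih =>
    obtain ⟨T, hT, hT1, hT2⟩ := ih (by omega)
    have hlt : 0 < (S \ T).card := by
      rw [Finset.card_sdiff_of_subset hT]; omega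
    obtain ⟨x, hx⟩ := Finset.card_pos.1 hlt
    rw [Finset.mem_sdiff] at hx
    have hx1 : -x ∉ T := fun h => hx.2 (by simpa using hT1 _ h)
    have hx2 : x ≠ -x := by
      intro h
      have : x = 0 := zsp_two ho x (by nth_rw 1 [h]; simp)
      exact h0 (this ▸ hx.1)
    refine ⟨insert x (insert (-x) T), ?_, ?_, ?_⟩
    · intro y hy
      simp only [Finset.mem_insert] at hy
      rcases hy with rfl | rfl | hy
      · exact hx.1
      · exact hS _ hx.1
      · exact hT hy
    · intro y hy
      simp only [Finset.mem_insert] at hy ⊢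
      rcases hy with rfl | rfl | hy
      · simp
      · simp
      · exact Or.inr (Or.inr (hT1 _ hy))
    · rw [Finset.card_insert_of_notMem, Finset.card_insert_of_notMem hx1, hT2]
      · ring
      · simp [hx2, hx.2]

theorem zsp_even {G : Type} [AddCommGroup G] [Finite G] [DecidableEq G]
    (ho : Odd (Nat.card G)) {κ : Type} [DecidableEq κ] (J : Finset κ) (c : κ → ℕ) :
    ∀ (S : Finset G), (∀ x ∈ S, -x ∈ S) → (0 : G) ∉ S → (∑ i ∈ J, 2 * c i ≤ S.card) →
    ∃ C : κ → Finset G, (∀ i ∈ J, C i ⊆ S ∧ (C i).card = 2 * c i ∧ ∑ x ∈ C i, x = 0) ∧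
      ∀ i ∈ J, ∀ j ∈ J, i ≠ j → Disjoint (C i) (C j) := by
  induction J using Finset.induction_on with
  | empty => exact fun S _ _ _ => ⟨fun _ => ∅, by simp, by simp⟩
  | insert a J ha ih =>
    intro S hS h0 hc
    rw [Finset.sum_insert ha] at hc
    obtain ⟨T, hT, hT1, hT2⟩ := zsp_sym_sub ho S hS h0 (c a) (by omega)
    obtain ⟨C, hC, hC1⟩ := ih (S \ T) (by
        intro x hx
        rw [Finset.mem_sdiff] at hx ⊢
        exact ⟨hS _ hx.1, fun h => hx.2 (by simpa using hT1 _ h)⟩)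
      (fun h => h0 (Finset.mem_sdiff.1 h).1)
      (by rw [Finset.card_sdiff_of_subset hT]; omega)
    have hdis : ∀ j ∈ J, Disjoint T (C j) := fun j hj =>
      Finset.disjoint_of_subset_right (hC j hj).1 Finset.disjoint_sdiff
    refine ⟨fun i => if i = a then T else C i, ?_, ?_⟩
    · intro i hi
      by_cases h : i = a
      · subst h
        simp only [if_true]
        exact ⟨hT, hT2, zsp_sym_sum ho T hT1⟩
      · simp only [if_neg h]
        have := hC i ((Finset.mem_insert.1 hi).resolve_left h)
        exact ⟨this.1.trans Finset.sdiff_subset, this.2⟩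
    · intro i hi j hj hij
      rw [Finset.mem_insert] at hi hj
      by_cases h : i = a
      · subst h
        simp only [if_true, if_neg (Ne.symm hij)]
        exact hdis j (hj.resolve_left (Ne.symm hij))
      · by_cases h' : j = a
        · subst h'
          simp only [if_true, if_neg h]
          exact (hdis i (hi.resolve_left h)).symm
        · simp only [if_neg h, if_neg h']
          exact hC1 i (hi.resolve_left h) j (hj.resolve_left h') hij

theorem zsp_complete {G : Type} [AddCommGroup G] [Fintype G] [DecidableEq G]
    (ho : Odd (Nat.card G)) {κ : Type} [Fintype κ] [DecidableEq κ] (r : κ → ℕ)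
    (hr : ∑ i, r i = Fintype.card G) (B : κ → Finset G)
    (hB : ∀ i j, i ≠ j → Disjoint (B i) (B j)) (hB0 : ∀ i, ∑ x ∈ B i, x = 0)
    (hBr : ∀ i, ∃ c, r i = (B i).card + 2 * c)
    (hsym : ∀ i, ∀ x ∈ B i, ∃ j, -x ∈ B j) (hz : ∃ i, (0 : G) ∈ B i) :
    ∃ P : κ → Finset G,
      (∀ i j, i ≠ j → Disjoint (P i) (P j)) ∧
      Finset.univ.biUnion P = Finset.univ ∧
      ∀ i, (P i).card = r i ∧ ∑ a ∈ P i, a = 0 := by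
  choose c hc using hBr
  have hU : (Finset.univ.biUnion B).card = ∑ i, (B i).card :=
    Finset.card_biUnion (fun i _ j _ h => hB i j h)
  obtain ⟨C, hC, hC1⟩ := zsp_even ho Finset.univ c (Finset.univ.biUnion B)ᶜ (by
      intro x hx
      simp only [Finset.mem_compl, Finset.mem_biUnion, Finset.mem_univ, true_and] at hx ⊢
      rintro ⟨i, hi⟩
      obtain ⟨j, hj⟩ := hsym i _ hi
      exact hx ⟨j, by simpa using hj⟩)
    (by simpa using hz)
    (by
      rw [Finset.card_compl, hU, ← hr]
      simp only [hc, Finset.sum_add_distrib]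
      omega)
  have hBC : ∀ i j, Disjoint (B i) (C j) := by
    intro i j
    refine Finset.disjoint_of_subset_right (hC j (Finset.mem_univ _)).1 ?_
    exact Finset.disjoint_of_subset_left (Finset.subset_biUnion_of_mem B (Finset.mem_univ i))
      disjoint_compl_right
  have hdis : ∀ i j, i ≠ j → Disjoint (B i ∪ C i) (B j ∪ C j) := by
    intro i j h
    rw [Finset.disjoint_union_left, Finset.disjoint_union_right, Finset.disjoint_union_right]
    exact ⟨⟨hB i j h, hBC i j⟩, (hBC j i).symm,
      hC1 i (Finset.mem_univ _) j (Finset.mem_univ _) h⟩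
  have hcard : ∀ i, (B i ∪ C i).card = r i := by
    intro i
    rw [Finset.card_union_of_disjoint (hBC i i), (hC i (Finset.mem_univ _)).2.1, hc]
  refine ⟨fun i => B i ∪ C i, hdis, ?_, fun i => ⟨hcard i, ?_⟩⟩
  · rw [← Finset.card_eq_iff_eq_univ, Finset.card_biUnion (fun i _ j _ h => hdis i j h), ← hr]
    exact Finset.sum_congr rfl fun i _ => hcard i
  · rw [Finset.sum_union (hBC i i), hB0, (hC i (Finset.mem_univ _)).2.2, add_zero]

/-- Let `s = r 0 + r 1 + ... + r (q-1)` be a partition of the positive odd integer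
`s`, where the first part is at least 1 and every other part is at least 2, and let
`A` be an Abelian group of order `s`. Then `A` can be partitioned into pairwise
disjoint subsets `P i` with `|P i| = r i` and `∑_{a ∈ P i} a = 0` for all `i`. -/
theorem zero_sum_partition_of_odd_order
    (q : ℕ) (hq : 0 < q) (r : Fin q → ℕ)
    (hr1 : 1 ≤ r ⟨0, hq⟩) (hr : ∀ i : Fin q, 0 < (i : ℕ) → 2 ≤ r i)
    (s : ℕ) (hs : s = ∑ i, r i) (hodd : Odd s)
    (A : Type) [AddCommGroup A] [Fintype A] [DecidableEq A]
    (hA : Fintype.card A = s) :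
    ∃ P : Fin q → Finset A,
      (∀ i j, i ≠ j → Disjoint (P i) (P j)) ∧
      Finset.univ.biUnion P = Finset.univ ∧
      ∀ i, (P i).card = r i ∧ ∑ a ∈ P i, a = 0 := by
  have ho : Odd (Nat.card A) := by rwa [Nat.card_eq_fintype_card, hA]
  obtain ⟨ι, _, f, hf, hfc⟩ := zsp_has _ A rfl ho
  -- the index receiving `0`
  have hO : Odd (Finset.univ.filter (fun i => Odd (r i))).card := by
    rw [← Finset.odd_sum_iff_odd_card_odd, ← hs]
    exact hodd
  obtain ⟨i0, hi0, hge⟩ : ∃ i0, Odd (r i0) ∧ ∀ i, i ≠ i0 → 2 ≤ r i := by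
    by_cases h : r ⟨0, hq⟩ = 1
    · refine ⟨⟨0, hq⟩, by rw [h]; exact odd_one, fun i hi => hr i ?_⟩
      rw [Nat.pos_iff_ne_zero]
      exact fun h => hi (Fin.ext h)
    · obtain ⟨i0, hi0⟩ := Finset.card_pos.1 hO.pos
      refine ⟨i0, (Finset.mem_filter.1 hi0).2, fun i _ => ?_⟩
      rcases Nat.eq_zero_or_pos (i : ℕ) with h0 | h0
      · have : i = ⟨0, hq⟩ := Fin.ext h0
        rw [this]; omega
      · exact hr i h0
  let O : Finset (Fin q) := (Finset.univ.filter (fun i => Odd (r i))).erase i0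
  have hOm : ∀ i, i ∈ O ↔ i ≠ i0 ∧ Odd (r i) := by
    intro i; simp [O]
  obtain ⟨m, hm⟩ : ∃ m, O.card = m * 2 := by
    have h1 : O.card = _ := Finset.card_erase_of_mem (by simpa using hi0)
    obtain ⟨t, ht⟩ := hO
    exact ⟨t, by omega⟩
  have hO3 : ∀ i ∈ O, 3 ≤ r i := by
    intro i hi
    rw [hOm] at hi
    have := hge i hi.1
    obtain ⟨t, ht⟩ := hi.2
    omega
  have hmk : m ≤ Nat.card ι := by
    have h1 : ∑ i ∈ O, 3 ≤ ∑ i ∈ O, r i := Finset.sum_le_sum hO3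
    have h2 : ∑ i ∈ insert i0 O, r i ≤ ∑ i, r i :=
      Finset.sum_le_sum_of_subset (Finset.subset_univ _)
    rw [Finset.sum_insert (by simp [hOm]), ← hs] at h2
    rw [Finset.sum_const, hm, smul_eq_mul] at h1
    rw [Nat.card_eq_fintype_card, hA] at hfc
    have := hi0.pos
    omega
  have : Fintype ι := Fintype.ofFinite ι
  obtain ⟨u⟩ : Nonempty (Fin m ↪ ι) := by
    apply Function.Embedding.nonempty_of_card_le
    rwa [Fintype.card_fin, ← Nat.card_eq_fintype_card]
  let e : O ≃ Fin m × Bool := Fintype.equivOfCardEq (by simp [hm])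
  -- the signed triples
  let σ : Bool → A → A := fun b x => if b then x else -x
  have hσ : ∀ b x, -(σ b x) = σ (!b) x := by
    intro b x; cases b <;> simp [σ]
  have hf0 : ∀ i j, f i j ≠ 0 := by
    intro i j h
    exact hf.neg i j i j (by rw [h, neg_zero])
  have hσ0 : ∀ b i j, σ b (f i j) ≠ 0 := by
    intro b i j
    cases b <;> simp [σ, hf0]
  have hσinj : ∀ b i j b' i' j', σ b (f i j) = σ b' (f i' j') → b = b' ∧ i = i' ∧ j = j' := by
    intro b i j b' i' j' h
    cases b <;> cases b' <;> simp only [σ, if_true, Bool.false_eq_true, if_false] at h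
    · exact ⟨rfl, hf.inj _ _ _ _ (neg_injective h)⟩
    · exact absurd h.symm (hf.neg _ _ _ _)
    · exact absurd h (hf.neg _ _ _ _)
    · exact ⟨rfl, hf.inj _ _ _ _ h⟩
  let T : Fin m × Bool → Finset A := fun p =>
    Finset.univ.image (fun j : Fin 3 => σ p.2 (f (u p.1) j))
  have hTm : ∀ p x, x ∈ T p ↔ ∃ j, σ p.2 (f (u p.1) j) = x := by
    intro p x; simp [T]
  have hTinj : ∀ p : Fin m × Bool, Function.Injective (fun j : Fin 3 => σ p.2 (f (u p.1) j)) :=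
    fun p j j' h => (hσinj _ _ _ _ _ _ h).2.2
  have hTc : ∀ p, (T p).card = 3 := by
    intro p
    simp only [T]
    rw [Finset.card_image_of_injective _ (hTinj p)]; simp
  have hTs : ∀ p, ∑ x ∈ T p, x = 0 := by
    rintro ⟨a, b⟩
    simp only [T]
    rw [Finset.sum_image (fun j _ j' _ h => hTinj (a, b) h), Fin.sum_univ_three]
    have h := hf.sum (u a)
    cases b
    · simp only [σ, Bool.false_eq_true, if_false]
      rw [← neg_add, ← neg_add, h, neg_zero]
    · simpa [σ] using h
  have hTd : ∀ p p', p ≠ p' → Disjoint (T p) (T p') := by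
    intro p p' h
    rw [Finset.disjoint_left]
    intro x hx hx'
    rw [hTm] at hx hx'
    obtain ⟨j, rfl⟩ := hx
    obtain ⟨j', h'⟩ := hx'
    have := hσinj _ _ _ _ _ _ h'
    exact h (Prod.ext (u.injective this.2.1.symm) this.1.symm)
  have hT0 : ∀ p, (0 : A) ∉ T p := by
    intro p h
    rw [hTm] at h
    obtain ⟨j, h⟩ := h
    exact hσ0 _ _ _ h
  let B : Fin q → Finset A := fun i =>
    if i = i0 then {0} else if h : i ∈ O then T (e ⟨i, h⟩) else ∅
  have hB1 : B i0 = {0} := by simp [B]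
  have hB2 : ∀ i (h : i ∈ O), B i = T (e ⟨i, h⟩) := by
    intro i h
    have : i ≠ i0 := ((hOm i).1 h).1
    simp [B, this, h]
  have hB3 : ∀ i, i ≠ i0 → i ∉ O → B i = ∅ := by
    intro i h h'
    simp [B, h, h']
  have hcases : ∀ i, i = i0 ∨ i ∈ O ∨ (i ≠ i0 ∧ i ∉ O) := by
    intro i; tauto
  refine zsp_complete ho r (by rw [hA, hs]) B ?_ ?_ ?_ ?_ ⟨i0, by simp [hB1]⟩
  · intro i j hij
    rcases hcases i with rfl | hi | hi
    · rcases hcases j with rfl | hj | hj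
      · exact absurd rfl hij
      · rw [hB1, hB2 j hj, Finset.disjoint_singleton_left]
        exact hT0 _
      · rw [hB3 j hj.1 hj.2]; exact Finset.disjoint_empty_right _
    · rcases hcases j with rfl | hj | hj
      · rw [hB1, hB2 i hi, Finset.disjoint_singleton_right]
        exact hT0 _
      · rw [hB2 i hi, hB2 j hj]
        apply hTd
        intro h
        exact hij (congrArg Subtype.val (e.injective h))
      · rw [hB3 j hj.1 hj.2]; exact Finset.disjoint_empty_right _
    · rw [hB3 i hi.1 hi.2]; exact Finset.disjoint_empty_left _
  · intro i
    rcases hcases i with rfl | hi | hi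
    · simp [hB1]
    · rw [hB2 i hi, hTs]
    · simp [hB3 i hi.1 hi.2]
  · intro i
    rcases hcases i with rfl | hi | hi
    · obtain ⟨t, ht⟩ := hi0
      exact ⟨t, by rw [hB1, ht, Finset.card_singleton]; ring⟩
    · rw [hB2 i hi, hTc]
      have h3 := hO3 i hi
      obtain ⟨t, ht⟩ := ((hOm i).1 hi).2
      exact ⟨t - 1, by omega⟩
    · rw [hB3 i hi.1 hi.2]
      have : Even (r i) := by
        rw [← Nat.not_odd_iff_even]
        exact fun h => hi.2 ((hOm i).2 ⟨hi.1, h⟩)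
      obtain ⟨t, ht⟩ := this
      exact ⟨t, by rw [ht, Finset.card_empty]; ring⟩
  · intro i x hx
    rcases hcases i with rfl | hi | hi
    · rw [hB1, Finset.mem_singleton] at hx
      exact ⟨i, by rw [hB1, hx]; simp⟩
    · rw [hB2 i hi, hTm] at hx
      obtain ⟨j, rfl⟩ := hx
      refine ⟨e.symm ((e ⟨i, hi⟩).1, !(e ⟨i, hi⟩).2), ?_⟩
      rw [hB2 _ (e.symm _).2, hTm]
      refine ⟨j, ?_⟩
      rw [hσ]
      simp
    · rw [hB3 i hi.1 hi.2] at hx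
      simp at hx
end
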